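/- Consider a discrete memoryless state-dependent relay channel p(y2,y3|x1,x2,s) with i.i.d. state S_j ~ p(s) known non-causally and perfectly only at the source, where a single message W13 is sent from the source to the destination with the help of the relay. Let T1, X2, Ŷ2 be random variables on finite alphabets with joint pmf p(s)·p(x2)·p(t1|s)·p(x1|t1,s)·p(y2,y3|x1,x2,s)·p(ŷ2|y2,x2). If R13 < I(T1;Ŷ2,Y3|X2) − I(T1;S), subject to the constraint I(Ŷ2;Y2|X2,Y3) ≤ I(X2;Y3), then the rate R13 is achievable (this is the specialization of the SD-RCPM non-causal region obtained by setting K2, T2, S2 trivial, S1=S, and Q2=X2). -/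

import Mathlib

/- Statement 7: Achievable rate (compress-and-forward with Gel'fand–Pinsker coding)
for the discrete memoryless state-dependent relay channel with non-causal perfect CSI
only at the source. -/

open Finset
open scoped Classical

noncomputable section

/-- `p` is a probability mass function on a finite type. -/
def IsPmf {A : Type} [Fintype A] (p : A → ℝ) : Prop :=
  (∀ a, 0 ≤ p a) ∧ ∑ a, p a = 1

/-- `p` is a transition kernel: for each `a`, `p a` is a pmf. -/
def IsKernel {A B : Type} [Fintype B] (p : A → B → ℝ) : Prop :=
  ∀ a, IsPmf (p a)

/-- Distribution (pmf) of a random variable `X` under the pmf `μ` on `Ω`. -/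
def rvDist {Ω A : Type} [Fintype Ω] (μ : Ω → ℝ) (X : Ω → A) (a : A) : ℝ :=
  ∑ ω, if X ω = a then μ ω else 0

/-- Shannon entropy (in bits) of the random variable `X` under `μ`. -/
def rvEnt {Ω A : Type} [Fintype Ω] [Fintype A] (μ : Ω → ℝ) (X : Ω → A) : ℝ :=
  -∑ a, rvDist μ X a * Real.logb 2 (rvDist μ X a)

/-- Mutual information `I(X;Y)` under `μ`. -/
def rvMI {Ω A B : Type} [Fintype Ω] [Fintype A] [Fintype B]
    (μ : Ω → ℝ) (X : Ω → A) (Y : Ω → B) : ℝ :=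
  rvEnt μ X + rvEnt μ Y - rvEnt μ (fun ω => (X ω, Y ω))

/-- Conditional mutual information `I(X;Y|Z)` under `μ`. -/
def rvCMI {Ω A B C : Type} [Fintype Ω] [Fintype A] [Fintype B] [Fintype C]
    (μ : Ω → ℝ) (X : Ω → A) (Y : Ω → B) (Z : Ω → C) : ℝ :=
  rvEnt μ (fun ω => (X ω, Z ω)) + rvEnt μ (fun ω => (Y ω, Z ω))
    - rvEnt μ (fun ω => (X ω, Y ω, Z ω)) - rvEnt μ Z

section SDRC

variable {𝒳₁ 𝒳₂ 𝒴₂ 𝒴₃ 𝒮 : Type}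
  [Fintype 𝒳₁] [Fintype 𝒳₂] [Fintype 𝒴₂] [Fintype 𝒴₃] [Fintype 𝒮]

/-- Average probability of error of a `(M13, n)` code for the SD-RC with non-causal
perfect CSI only at the source: the message is uniform, states i.i.d. `∼ pS`, channel
memoryless `W`; the relay has no state information and no message. -/
def errProbRCsrc (pS : 𝒮 → ℝ) (W : 𝒳₁ → 𝒳₂ → 𝒮 → 𝒴₂ × 𝒴₃ → ℝ)
    {n M13 : ℕ}
    (enc1 : Fin M13 → (Fin n → 𝒮) → Fin n → 𝒳₁)
    (enc2 : (Fin n → 𝒴₂) → Fin n → 𝒳₂)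
    (dec2 : (Fin n → 𝒴₃) → Fin M13) : ℝ :=
  ∑ w13 : Fin M13, ∑ sv : Fin n → 𝒮, ∑ yv : Fin n → 𝒴₂ × 𝒴₃,
    if dec2 (fun j => (yv j).2) = w13 then 0
    else (M13 : ℝ)⁻¹ * (∏ j, pS (sv j)) *
      ∏ j, W (enc1 w13 sv j) (enc2 (fun i => (yv i).1) j) (sv j) (yv j)

/-- Achievability of a rate `R13` for the SD-RC with non-causal perfect CSI only at
the source. -/
def AchievableRCsrc (pS : 𝒮 → ℝ) (W : 𝒳₁ → 𝒳₂ → 𝒮 → 𝒴₂ × 𝒴₃ → ℝ)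
    (R13 : ℝ) : Prop :=
  ∀ ε : ℝ, 0 < ε →
    ∃ (n M13 : ℕ)
      (enc1 : Fin M13 → (Fin n → 𝒮) → Fin n → 𝒳₁)
      (enc2 : (Fin n → 𝒴₂) → Fin n → 𝒳₂)
      (dec2 : (Fin n → 𝒴₃) → Fin M13),
      0 < n ∧
      (2 : ℝ) ^ ((n : ℝ) * R13) ≤ M13 ∧
      (∀ y y' (j : Fin n), (∀ i, i < j → y i = y' i) → enc2 y j = enc2 y' j) ∧
      errProbRCsrc pS W enc1 enc2 dec2 ≤ ε

end SDRC

section Joint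

variable {𝒮 T₁ 𝒳₁ 𝒳₂ 𝒴₂ 𝒴₃ YH : Type}

/-- Sample space carrying `(S, T₁, X₁, X₂, Y₂, Y₃, Ŷ₂)`. -/
abbrev ΩRCsrc (𝒮 T₁ 𝒳₁ 𝒳₂ 𝒴₂ 𝒴₃ YH : Type) : Type :=
  𝒮 × T₁ × 𝒳₁ × 𝒳₂ × 𝒴₂ × 𝒴₃ × YH

def vS (ω : ΩRCsrc 𝒮 T₁ 𝒳₁ 𝒳₂ 𝒴₂ 𝒴₃ YH) : 𝒮 := ω.1
def vT1 (ω : ΩRCsrc 𝒮 T₁ 𝒳₁ 𝒳₂ 𝒴₂ 𝒴₃ YH) : T₁ := ω.2.1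
def vX1 (ω : ΩRCsrc 𝒮 T₁ 𝒳₁ 𝒳₂ 𝒴₂ 𝒴₃ YH) : 𝒳₁ := ω.2.2.1
def vX2 (ω : ΩRCsrc 𝒮 T₁ 𝒳₁ 𝒳₂ 𝒴₂ 𝒴₃ YH) : 𝒳₂ := ω.2.2.2.1
def vY2 (ω : ΩRCsrc 𝒮 T₁ 𝒳₁ 𝒳₂ 𝒴₂ 𝒴₃ YH) : 𝒴₂ := ω.2.2.2.2.1
def vY3 (ω : ΩRCsrc 𝒮 T₁ 𝒳₁ 𝒳₂ 𝒴₂ 𝒴₃ YH) : 𝒴₃ := ω.2.2.2.2.2.1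
def vYH (ω : ΩRCsrc 𝒮 T₁ 𝒳₁ 𝒳₂ 𝒴₂ 𝒴₃ YH) : YH := ω.2.2.2.2.2.2

end Joint

/-! ### Expectations over finite probability spaces -/

/-- Expectation of `f` under the weight function `p`. -/
def Ex {A : Type} [Fintype A] (p f : A → ℝ) : ℝ := ∑ a, p a * f a

/-- Real-valued indicator of a proposition. -/
def ind (P : Prop) : ℝ := if P then 1 else 0

/-- Product pmf on a function space. -/
def piPmf {ι A : Type} [Fintype ι] (p : ι → A → ℝ) (f : ι → A) : ℝ := ∏ i, p i (f i)

lemma ind_nonneg (P : Prop) : 0 ≤ ind P := by unfold ind; split_ifs <;> norm_num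

lemma ind_le_one (P : Prop) : ind P ≤ 1 := by unfold ind; split_ifs <;> norm_num

lemma ind_true {P : Prop} (h : P) : ind P = 1 := by simp [ind, h]

lemma ind_false {P : Prop} (h : ¬P) : ind P = 0 := by simp [ind, h]

lemma ind_le_of_imp {P : Prop} {x : ℝ} (h0 : 0 ≤ x) (h : P → 1 ≤ x) : ind P ≤ x := by
  by_cases hP : P
  · rw [ind_true hP]; exact h hP
  · rw [ind_false hP]; exact h0

section Expectation

variable {A B ι : Type} [Fintype A] [Fintype B] [Fintype ι]

lemma Ex_mono {p f g : A → ℝ} (hp : ∀ a, 0 ≤ p a) (h : ∀ a, f a ≤ g a) : Ex p f ≤ Ex p g :=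
  Finset.sum_le_sum fun a _ => mul_le_mul_of_nonneg_left (h a) (hp a)

lemma Ex_congr {p f g : A → ℝ} (h : ∀ a, f a = g a) : Ex p f = Ex p g := by
  simp only [Ex, h]

lemma Ex_nonneg {p f : A → ℝ} (hp : ∀ a, 0 ≤ p a) (h : ∀ a, 0 ≤ f a) : 0 ≤ Ex p f :=
  Finset.sum_nonneg fun a _ => mul_nonneg (hp a) (h a)

lemma Ex_const {p : A → ℝ} (hp : IsPmf p) (c : ℝ) : Ex p (fun _ => c) = c := by
  rw [Ex, ← Finset.sum_mul, hp.2, one_mul]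

lemma Ex_le_of_le {p f : A → ℝ} (hp : IsPmf p) {c : ℝ} (h : ∀ a, f a ≤ c) : Ex p f ≤ c :=
  (Ex_mono hp.1 h).trans_eq (Ex_const hp c)

lemma Ex_add (p f g : A → ℝ) : Ex p (fun a => f a + g a) = Ex p f + Ex p g := by
  simp only [Ex, mul_add, Finset.sum_add_distrib]

lemma Ex_mul_left (p f : A → ℝ) (c : ℝ) : Ex p (fun a => c * f a) = c * Ex p f := by
  simp only [Ex, Finset.mul_sum]
  exact Finset.sum_congr rfl fun _ _ => by ring

lemma Ex_sum {C : Type} (p : A → ℝ) (f : C → A → ℝ) (t : Finset C) :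
    Ex p (fun a => ∑ b ∈ t, f b a) = ∑ b ∈ t, Ex p (f b) := by
  simp only [Ex, Finset.mul_sum]
  exact Finset.sum_comm

lemma Ex_comm (p : A → ℝ) (q : B → ℝ) (F : A → B → ℝ) :
    Ex p (fun a => Ex q (F a)) = Ex q (fun b => Ex p (fun a => F a b)) := by
  simp only [Ex, Finset.mul_sum]
  rw [Finset.sum_comm]
  exact Finset.sum_congr rfl fun _ _ => Finset.sum_congr rfl fun _ _ => by ring

lemma exists_le_Ex {p f : A → ℝ} (hp : IsPmf p) {c : ℝ} (h : Ex p f ≤ c) : ∃ a, f a ≤ c := by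
  by_contra! hc
  have hs : ∃ a ∈ Finset.univ, 0 < p a := by
    apply Finset.exists_lt_of_sum_lt
    simp [hp.2]
  obtain ⟨a₀, -, ha₀⟩ := hs
  have : Ex p (fun _ => c) < Ex p f :=
    Finset.sum_lt_sum (fun a _ => mul_le_mul_of_nonneg_left (hc a).le (hp.1 a))
      ⟨a₀, Finset.mem_univ _, mul_lt_mul_of_pos_left (hc a₀) ha₀⟩
  rw [Ex_const hp] at this
  linarith

lemma sum_piPmf [DecidableEq ι] (p : ι → A → ℝ) :
    ∑ f, piPmf p f = ∏ i, ∑ a, p i a := by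
  simp only [piPmf]
  rw [Finset.prod_univ_sum, Fintype.piFinset_univ]

lemma isPmf_piPmf [DecidableEq ι] {p : ι → A → ℝ} (hp : ∀ i, IsPmf (p i)) :
    IsPmf (piPmf p) := by
  refine ⟨fun f => Finset.prod_nonneg fun i _ => (hp i).1 _, ?_⟩
  rw [sum_piPmf]
  exact Finset.prod_eq_one fun i _ => (hp i).2

lemma piPmf_update_mul {C : Type} [DecidableEq ι] (p : ι → C → ℝ) (i : ι) (f : ι → C) (a : C) :
    piPmf p (Function.update f i a) * p i (f i) = piPmf p f * p i a := by
  unfold piPmf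
  rw [← Finset.mul_prod_erase _ _ (Finset.mem_univ i),
    ← Finset.mul_prod_erase _ (fun j => p j (f j)) (Finset.mem_univ i)]
  have : ∏ j ∈ Finset.univ.erase i, p j (Function.update f i a j)
      = ∏ j ∈ Finset.univ.erase i, p j (f j) :=
    Finset.prod_congr rfl fun j hj => by
      rw [Function.update_of_ne (Finset.ne_of_mem_erase hj)]
  rw [this, Function.update_self]
  ring

/-- A coordinate of an independent family may be redrawn without changing expectations. -/
lemma Ex_pi_resample [DecidableEq ι] {p : ι → A → ℝ} (i : ι) (hp : IsPmf (p i))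
    (F : (ι → A) → ℝ) :
    Ex (piPmf p) F =
      Ex (piPmf p) (fun f => Ex (p i) (fun a => F (Function.update f i a))) := by
  have hinv : Function.Involutive
      (fun x : (ι → A) × A => (Function.update x.1 i x.2, x.1 i)) := by
    rintro ⟨f, a⟩
    simp
  have h1 : ∑ x : (ι → A) × A, piPmf p x.1 * p i x.2 * F (Function.update x.1 i x.2)
      = ∑ x : (ι → A) × A, piPmf p x.1 * p i x.2 * F x.1 := by
    rw [← Equiv.sum_comp hinv.toPerm
      (fun x : (ι → A) × A => piPmf p x.1 * p i x.2 * F x.1)]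
    refine Finset.sum_congr rfl fun x _ => ?_
    simp only [Function.Involutive.coe_toPerm]
    rw [piPmf_update_mul]
  rw [Fintype.sum_prod_type, Fintype.sum_prod_type] at h1
  have h2 : ∑ f : ι → A, ∑ a, piPmf p f * p i a * F f = Ex (piPmf p) F := by
    refine Finset.sum_congr rfl fun f _ => ?_
    rw [← Finset.sum_mul, ← Finset.mul_sum, hp.2, mul_one]
  rw [← h2, ← h1]
  refine Finset.sum_congr rfl fun f _ => ?_
  simp only [Ex, Finset.mul_sum]
  exact Finset.sum_congr rfl fun _ _ => by ring

lemma Ex_pi_eval [DecidableEq ι] {p : ι → A → ℝ} (hp : ∀ i, IsPmf (p i)) (i : ι)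
    (G : A → ℝ) : Ex (piPmf p) (fun f => G (f i)) = Ex (p i) G := by
  rw [Ex_pi_resample i (hp i)]
  simp only [Function.update_self]
  exact Ex_const (isPmf_piPmf hp) _

/-- Second moment of a sum of independent centred variables. -/
lemma Ex_pi_sum_sq [DecidableEq ι] {p : A → ℝ} (hp : IsPmf p) {g : A → ℝ}
    (hg : Ex p g = 0) :
    Ex (piPmf fun _ : ι => p) (fun f => (∑ i, g (f i)) ^ 2)
      = Fintype.card ι * Ex p (fun a => g a ^ 2) := by
  have hoff : ∀ i j : ι, Ex (piPmf fun _ : ι => p) (fun f => g (f i) * g (f j))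
      = if i = j then Ex p (fun a => g a ^ 2) else 0 := by
    intro i j
    split_ifs with hij
    · subst hij
      simp only [← pow_two]
      exact Ex_pi_eval (p := fun _ : ι => p) (fun _ => hp) i (fun a => g a ^ 2)
    · rw [Ex_pi_resample j hp]
      simp only [Function.update_self, Function.update_of_ne hij, Ex_mul_left, hg, mul_zero]
      exact Ex_const (isPmf_piPmf fun _ => hp) 0
  have : ∀ f : ι → A, (∑ i, g (f i)) ^ 2 = ∑ i, ∑ j, g (f i) * g (f j) := fun f => by
    rw [pow_two, Finset.sum_mul_sum]
  simp only [this, Ex_sum, hoff]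
  simp

/-- Chebyshev's inequality for independent centred variables. -/
lemma Ex_pi_chebyshev [DecidableEq ι] {p : A → ℝ} (hp : IsPmf p) {g : A → ℝ}
    (hg : Ex p g = 0) {c : ℝ} (hc : 0 < c) (P : (ι → A) → Prop)
    (hP : ∀ f, P f → c ^ 2 ≤ (∑ i, g (f i)) ^ 2) :
    Ex (piPmf fun _ : ι => p) (fun f => ind (P f))
      ≤ Fintype.card ι * Ex p (fun a => g a ^ 2) / c ^ 2 := by
  have hc2 : 0 < c ^ 2 := by positivity
  rw [le_div_iff₀ hc2, mul_comm, ← Ex_pi_sum_sq hp hg, ← Ex_mul_left]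
  refine Ex_mono (isPmf_piPmf fun _ => hp).1 fun f => ?_
  by_cases h : P f
  · rw [ind_true h, mul_one]; exact hP f h
  · rw [ind_false h, mul_zero]; positivity

end Expectation

/-! ### Covering by a random codebook -/

section Covering

variable {U ι : Type} [Fintype U] [Fintype ι]

/-- Likelihood ratio of `p` with respect to `q`, set to zero where it exceeds `Γ`. -/
def truncRatio (p q : U → ℝ) (Γ : ℝ) (u : U) : ℝ := if p u ≤ Γ * q u then p u / q u else 0

/-- Index selection with probabilities proportional to the truncated likelihood ratios; a
default index is used when these ratios have a small sum. -/
def selKernel [DecidableEq ι] (i₀ : ι) (p q : U → ℝ) (Γ : ℝ) (u : ι → U) (i : ι) : ℝ :=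
  if (Fintype.card ι : ℝ) / 2 ≤ ∑ j, truncRatio p q Γ (u j) then
    truncRatio p q Γ (u i) / ∑ j, truncRatio p q Γ (u j)
  else if i = i₀ then 1 else 0

lemma truncRatio_nonneg {p q : U → ℝ} {Γ : ℝ} (hp : IsPmf p) (hq : IsPmf q) (u : U) :
    0 ≤ truncRatio p q Γ u := by
  unfold truncRatio
  split_ifs
  · exact div_nonneg (hp.1 u) (hq.1 u)
  · exact le_rfl

lemma truncRatio_le {p q : U → ℝ} {Γ : ℝ} (hΓ : 0 < Γ) (hq : IsPmf q) (u : U) :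
    truncRatio p q Γ u ≤ Γ := by
  unfold truncRatio
  split_ifs with h
  · exact div_le_of_le_mul₀ (hq.1 u) hΓ.le h
  · exact hΓ.le

lemma mul_truncRatio {p q : U → ℝ} {Γ : ℝ} (hp : IsPmf p) (u : U) :
    q u * truncRatio p q Γ u = p u * (1 - ind (Γ * q u < p u)) := by
  unfold truncRatio
  split_ifs with h
  · rw [ind_false (not_lt.2 h)]
    by_cases hq : q u = 0
    · have := hp.1 u
      rw [hq, mul_zero] at h
      rw [hq, le_antisymm h this]; simp
    · field_simp; simp
  · rw [ind_true (not_le.1 h)]; simp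

lemma selKernel_isPmf [DecidableEq ι] [Nonempty ι] (i₀ : ι) {p q : U → ℝ} {Γ : ℝ}
    (hp : IsPmf p) (hq : IsPmf q) (u : ι → U) : IsPmf (selKernel i₀ p q Γ u) := by
  have hcard : (0 : ℝ) < Fintype.card ι := by exact_mod_cast Fintype.card_pos
  constructor
  · intro i
    unfold selKernel
    split_ifs
    · exact div_nonneg (truncRatio_nonneg hp hq _)
        (Finset.sum_nonneg fun j _ => truncRatio_nonneg hp hq _)
    · exact zero_le_one
    · exact le_rfl
  · unfold selKernel
    split_ifs with h
    · rw [← Finset.sum_div]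
      exact div_self (by linarith)
    · simp

lemma sum_truncRatio_small [DecidableEq ι] [Nonempty ι] {p q : U → ℝ} {Γ : ℝ} (hΓ : 0 < Γ)
    (hp : IsPmf p) (hq : IsPmf q) :
    Ex (piPmf fun _ : ι => q)
        (fun u => ind (∑ j, truncRatio p q Γ (u j) < (Fintype.card ι : ℝ) / 2))
      ≤ 16 * Γ / Fintype.card ι + 4 * Ex p (fun u => ind (Γ * q u < p u)) := by
  have hcard : (0 : ℝ) < Fintype.card ι := by exact_mod_cast Fintype.card_pos
  set b := Ex p (fun u => ind (Γ * q u < p u)) with hb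
  have hb0 : 0 ≤ b := Ex_nonneg hp.1 fun _ => ind_nonneg _
  have hfrac : 0 ≤ 16 * Γ / (Fintype.card ι : ℝ) := by positivity
  set ρ := truncRatio p q Γ with hρ
  have hmean : Ex q ρ = 1 - b := by
    simp only [Ex, hρ, mul_truncRatio hp, mul_sub, mul_one, Finset.sum_sub_distrib, hp.2, hb]
  by_cases hlarge : 1 / 4 < b
  · calc _ ≤ (1 : ℝ) := Ex_le_of_le (isPmf_piPmf fun _ => hq) fun _ => ind_le_one _
      _ ≤ _ := by linarith
  push Not at hlarge
  have hcent : Ex q (fun u => ρ u + -(1 - b)) = 0 := by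
    rw [Ex_add, Ex_const hq, hmean]; ring
  have hvar : Ex q (fun u => (ρ u + -(1 - b)) ^ 2) ≤ Γ := by
    have h1 : ∀ u, (ρ u + -(1 - b)) ^ 2 ≤ (Γ - 2 * (1 - b)) * ρ u + (1 - b) ^ 2 := fun u => by
      have h2 := truncRatio_le (p := p) hΓ hq u
      have h3 := truncRatio_nonneg (Γ := Γ) hp hq u
      rw [← hρ] at h2 h3
      nlinarith
    refine (Ex_mono hq.1 h1).trans ?_
    rw [Ex_add, Ex_mul_left, Ex_const hq, hmean]
    nlinarith [sq_nonneg (1 - b)]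
  have hcheb := Ex_pi_chebyshev (ι := ι) hq hcent
    (c := (Fintype.card ι : ℝ) / 4) (by positivity)
    (fun u => ∑ j, ρ (u j) < (Fintype.card ι : ℝ) / 2) (by
      intro u hu
      have hs : ∑ i, (ρ (u i) + -(1 - b)) = ∑ i, ρ (u i) - Fintype.card ι * (1 - b) := by
        rw [Finset.sum_add_distrib]; simp; ring
      rw [hs]
      have : (Fintype.card ι : ℝ) / 4 ≤ Fintype.card ι * (1 - b) - ∑ i, ρ (u i) := by
        nlinarith
      nlinarith)
  refine hcheb.trans ?_
  calc _ ≤ (Fintype.card ι : ℝ) * Γ / ((Fintype.card ι : ℝ) / 4) ^ 2 := by gcongr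
    _ = 16 * Γ / Fintype.card ι := by field_simp; norm_num
    _ ≤ _ := by linarith

/-- The uniform pmf. -/
def unif (ι : Type) [Fintype ι] (_ : ι) : ℝ := (Fintype.card ι : ℝ)⁻¹

lemma isPmf_unif [Nonempty ι] : IsPmf (unif ι) := by
  have hcard : (Fintype.card ι : ℝ) ≠ 0 := by exact_mod_cast Fintype.card_ne_zero
  refine ⟨fun _ => by unfold unif; positivity, ?_⟩
  simp [unif, hcard]

/-- With a codebook drawn from `q`, the selected codeword behaves, up to a factor two and a
small additive error, as if it had been drawn from `p` at a uniformly distributed index. -/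
lemma covering [DecidableEq ι] [Nonempty ι] (i₀ : ι) {p q : U → ℝ} {Γ : ℝ} (hΓ : 0 < Γ)
    (hp : IsPmf p) (hq : IsPmf q) (c : ι → (ι → U) → ℝ) (hc0 : ∀ i u, 0 ≤ c i u)
    (hc1 : ∀ i u, c i u ≤ 1) :
    Ex (piPmf fun _ : ι => q) (fun u => Ex (selKernel i₀ p q Γ u) (fun i => c i u))
      ≤ 2 * Ex (unif ι) (fun i => Ex (piPmf fun _ : ι => q)
          (fun u => Ex p (fun a => c i (Function.update u i a))))
        + 16 * Γ / Fintype.card ι + 4 * Ex p (fun u => ind (Γ * q u < p u)) := by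
  have hcard : (0 : ℝ) < Fintype.card ι := by exact_mod_cast Fintype.card_pos
  set N : ℝ := (Fintype.card ι : ℝ) with hN
  have hpi := isPmf_piPmf fun _ : ι => hq
  have hpoint : ∀ u : ι → U, Ex (selKernel i₀ p q Γ u) (fun i => c i u)
      ≤ 2 / N * ∑ i, truncRatio p q Γ (u i) * c i u
        + ind (∑ j, truncRatio p q Γ (u j) < N / 2) := by
    intro u
    have hρ0 : ∀ j, 0 ≤ truncRatio p q Γ (u j) := fun j => truncRatio_nonneg hp hq _
    have hS : 0 ≤ ∑ i, truncRatio p q Γ (u i) * c i u :=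
      Finset.sum_nonneg fun i _ => mul_nonneg (hρ0 i) (hc0 i u)
    by_cases h : N / 2 ≤ ∑ j, truncRatio p q Γ (u j)
    · rw [ind_false (not_lt.2 h), add_zero]
      have : Ex (selKernel i₀ p q Γ u) (fun i => c i u)
          = (∑ i, truncRatio p q Γ (u i) * c i u) / ∑ j, truncRatio p q Γ (u j) := by
        rw [Ex, Finset.sum_div]
        refine Finset.sum_congr rfl fun i _ => ?_
        rw [selKernel, if_pos h]; ring
      rw [this]
      calc _ ≤ (∑ i, truncRatio p q Γ (u i) * c i u) / (N / 2) := by gcongr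
        _ = _ := by field_simp
    · rw [ind_true (not_le.1 h)]
      have h1 : Ex (selKernel i₀ p q Γ u) (fun i => c i u) ≤ 1 :=
        Ex_le_of_le (selKernel_isPmf i₀ hp hq u) fun i => hc1 i u
      have : 0 ≤ 2 / N * ∑ i, truncRatio p q Γ (u i) * c i u := by positivity
      linarith
  have hterm : ∀ i, Ex (piPmf fun _ : ι => q) (fun u => truncRatio p q Γ (u i) * c i u)
      ≤ Ex (piPmf fun _ : ι => q)
          (fun u => Ex p (fun a => c i (Function.update u i a))) := by
    intro i
    rw [Ex_pi_resample i hq]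
    refine Ex_mono hpi.1 fun u => Finset.sum_le_sum fun a _ => ?_
    simp only [Function.update_self]
    rw [← mul_assoc, mul_truncRatio hp]
    refine mul_le_mul_of_nonneg_right ?_ (hc0 _ _)
    nlinarith [hp.1 a, ind_nonneg (Γ * q a < p a)]
  refine (Ex_mono hpi.1 hpoint).trans ?_
  rw [Ex_add, Ex_mul_left, Ex_sum]
  have h2 := sum_truncRatio_small (ι := ι) hΓ hp hq
  have h3 : 2 / N * ∑ i, Ex (piPmf fun _ : ι => q)
      (fun u => truncRatio p q Γ (u i) * c i u) ≤ 2 * Ex (unif ι) (fun i =>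
        Ex (piPmf fun _ : ι => q)
          (fun u => Ex p (fun a => c i (Function.update u i a)))) := by
    rw [div_mul_eq_mul_div, mul_div_assoc, div_eq_inv_mul, Finset.mul_sum]
    gcongr
    refine Finset.sum_le_sum fun i _ => ?_
    simp only [unif, ← hN]
    gcongr
    exact hterm i
  linarith

end Covering

/-! ### Block codes -/

/-- Joint pmf of a pmf followed by a kernel. -/
def compPmf {A B : Type} (p : A → ℝ) (κ : A → B → ℝ) (x : A × B) : ℝ := p x.1 * κ x.1 x.2

section ChainRule

variable {A B : Type} [Fintype A] [Fintype B]

lemma Ex_compPmf (p : A → ℝ) (κ : A → B → ℝ) (F : A × B → ℝ) :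
    Ex (compPmf p κ) F = Ex p (fun a => Ex (κ a) (fun b => F (a, b))) := by
  simp only [Ex, compPmf, Fintype.sum_prod_type, Finset.mul_sum, mul_assoc]

lemma isPmf_compPmf {p : A → ℝ} {κ : A → B → ℝ} (hp : IsPmf p) (hκ : ∀ a, IsPmf (κ a)) :
    IsPmf (compPmf p κ) := by
  refine ⟨fun x => mul_nonneg (hp.1 _) ((hκ _).1 _), ?_⟩
  simp only [compPmf, Fintype.sum_prod_type, ← Finset.mul_sum, (hκ _).2, mul_one, hp.2]

end ChainRule

/-- A state-dependent relay channel with test distributions, together with the reference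
distributions `qT`, `qH` from which codebooks are drawn.  The channel output `y : Y` is seen
through `π₂` by the relay and through `π₃` by the destination. -/
structure RelayModel (S T X₁ X₂ Y Y₂ Y₃ H : Type) [Fintype S] [Fintype T] [Fintype X₁]
    [Fintype X₂] [Fintype Y] [Fintype H] where
  pS : S → ℝ
  pT : S → T → ℝ
  pX1 : T → S → X₁ → ℝ
  pX2 : X₂ → ℝ
  W : X₁ → X₂ → S → Y → ℝ
  pH : Y₂ → X₂ → H → ℝ
  qT : T → ℝ
  qH : X₂ → H → ℝ
  π₂ : Y → Y₂
  π₃ : Y → Y₃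
  hpS : IsPmf pS
  hpT : ∀ s, IsPmf (pT s)
  hpX1 : ∀ t s, IsPmf (pX1 t s)
  hpX2 : IsPmf pX2
  hW : ∀ x₁ x₂ s, IsPmf (W x₁ x₂ s)
  hpH : ∀ y x, IsPmf (pH y x)
  hqT : IsPmf qT
  hqH : ∀ x, IsPmf (qH x)

/-- One block of a block-Markov relaying scheme: `m : Mo` is the index known to the relay and
`w : Ms` the message. -/
structure BlockCode (S X₁ X₂ Y₂ Y₃ Mo Ms : Type) where
  enc : Ms → S → X₁
  word : Mo → X₂
  quant : Mo → Y₂ → Mo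
  decBin : Y₃ → Mo
  decMsg : Mo → Mo → Y₃ → Ms

/-- The block decoder fails to recover the relay index, or fails to recover the message when
given the true relay indices. -/
def BlockCode.Bad {S X₁ X₂ Y₂ Y₃ Mo Ms : Type} (C : BlockCode S X₁ X₂ Y₂ Y₃ Mo Ms)
    (m : Mo) (w : Ms) (y₂ : Y₂) (y₃ : Y₃) : Prop :=
  C.decBin y₃ ≠ m ∨ C.decMsg m (C.quant m y₂) y₃ ≠ w

namespace RelayModel

variable {S T X₁ X₂ Y Y₂ Y₃ H : Type} [Fintype S] [Fintype T] [Fintype X₁]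
  [Fintype X₂] [Fintype Y] [Fintype H] (D : RelayModel S T X₁ X₂ Y Y₂ Y₃ H)

/-- Expectation when all variables follow the test distribution. -/
def ideal (F : S → T → X₁ → X₂ → Y → H → ℝ) : ℝ :=
  Ex D.pX2 fun x => Ex D.pS fun s => Ex (D.pT s) fun t => Ex (D.pX1 t s) fun x₁ =>
    Ex (D.W x₁ x s) fun y => Ex (D.pH (D.π₂ y) x) fun a => F s t x₁ x y a

lemma ideal_mono {F G : S → T → X₁ → X₂ → Y → H → ℝ}
    (h : ∀ s t x₁ x y a, F s t x₁ x y a ≤ G s t x₁ x y a) : D.ideal F ≤ D.ideal G :=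
  Ex_mono D.hpX2.1 fun _ => Ex_mono D.hpS.1 fun _ => Ex_mono (D.hpT _).1 fun _ =>
    Ex_mono (D.hpX1 _ _).1 fun _ => Ex_mono (D.hW _ _ _).1 fun _ =>
      Ex_mono (D.hpH _ _).1 fun _ => h _ _ _ _ _ _

lemma ideal_add (F G : S → T → X₁ → X₂ → Y → H → ℝ) :
    D.ideal (fun s t x₁ x y a => F s t x₁ x y a + G s t x₁ x y a)
      = D.ideal F + D.ideal G := by
  simp only [ideal, Ex_add]

lemma ideal_mul_left (c : ℝ) (F : S → T → X₁ → X₂ → Y → H → ℝ) :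
    D.ideal (fun s t x₁ x y a => c * F s t x₁ x y a) = c * D.ideal F := by
  simp only [ideal, Ex_mul_left]

/-- Error probability of one block with relay index `m` and message `w`. -/
def blockErr {Mo Ms : Type} (C : BlockCode S X₁ X₂ Y₂ Y₃ Mo Ms) (m : Mo) (w : Ms) : ℝ :=
  Ex D.pS fun s => Ex (D.W (C.enc w s) (C.word m) s) fun y =>
    ind (C.Bad m w (D.π₂ y) (D.π₃ y))

section OneBlock

variable {Ix Ky : Type} [Fintype Ix] [Fintype Ky] [DecidableEq Ix] [DecidableEq Ky]
  [Nonempty Ix] [Nonempty Ky]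

/-- Replacement of both codeword selections by the test distribution at uniform indices. -/
lemma double_covering (l₀ : Ix) (k₀ : Ky) {Γ₁ Γ₂ η₁ η₂ B : ℝ} (hΓ₁ : 0 < Γ₁) (hΓ₂ : 0 < Γ₂)
    (hη₁ : D.ideal (fun s t _ _ _ _ => ind (Γ₁ * D.qT t < D.pT s t)) ≤ η₁)
    (hη₂ : D.ideal (fun _ _ _ x y a => ind (Γ₂ * D.qH x a < D.pH (D.π₂ y) x a)) ≤ η₂)
    (g : (Ix → T) → X₂ → (Ky → H) → Y₃ → Ky → ℝ)
    (hg0 : ∀ u x h y i, 0 ≤ g u x h y i) (hg1 : ∀ u x h y i, g u x h y i ≤ 1)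
    (hB : ∀ l i, D.ideal (fun _ t _ x y a => Ex (piPmf fun _ : Ix => D.qT) fun u =>
      Ex (piPmf fun _ : Ky => D.qH x) fun h =>
        g (Function.update u l t) x (Function.update h i a) (D.π₃ y) i) ≤ B) :
    (Ex (piPmf fun _ : Ix => D.qT) fun u => Ex D.pX2 fun x =>
      Ex (piPmf fun _ : Ky => D.qH x) fun h => Ex D.pS fun s =>
      Ex (selKernel l₀ (D.pT s) D.qT Γ₁ u) fun l => Ex (D.pX1 (u l) s) fun x₁ =>
      Ex (D.W x₁ x s) fun y =>
      Ex (selKernel k₀ (D.pH (D.π₂ y) x) (D.qH x) Γ₂ h) fun i => g u x h (D.π₃ y) i)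
    ≤ 4 * B + 2 * (16 * Γ₂ / Fintype.card Ky + 4 * η₂) + 16 * Γ₁ / Fintype.card Ix
      + 4 * η₁ := by
  set PL := piPmf fun _ : Ix => D.qT with hPL
  have hPLpmf : IsPmf PL := isPmf_piPmf fun _ => D.hqT
  have hPHpmf : ∀ x, IsPmf (piPmf fun _ : Ky => D.qH x) := fun x => isPmf_piPmf fun _ => D.hqH x
  set c : X₂ → S → Ix → (Ix → T) → ℝ := fun x s l u => Ex (D.pX1 (u l) s) fun x₁ =>
      Ex (D.W x₁ x s) fun y => Ex (piPmf fun _ : Ky => D.qH x) fun h =>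
      Ex (selKernel k₀ (D.pH (D.π₂ y) x) (D.qH x) Γ₂ h) fun i => g u x h (D.π₃ y) i with hc
  have hsel : ∀ x y h, IsPmf (selKernel k₀ (D.pH (D.π₂ y) x) (D.qH x) Γ₂ h) := fun x y h =>
    selKernel_isPmf k₀ (D.hpH _ _) (D.hqH _) _
  have hc0 : ∀ x s l u, 0 ≤ c x s l u := fun x s l u =>
    Ex_nonneg (D.hpX1 _ _).1 fun _ => Ex_nonneg (D.hW _ _ _).1 fun _ =>
      Ex_nonneg (hPHpmf _).1 fun _ => Ex_nonneg (hsel _ _ _).1 fun _ => hg0 _ _ _ _ _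
  have hc1 : ∀ x s l u, c x s l u ≤ 1 := fun x s l u =>
    Ex_le_of_le (D.hpX1 _ _) fun _ => Ex_le_of_le (D.hW _ _ _) fun _ =>
      Ex_le_of_le (hPHpmf _) fun _ => Ex_le_of_le (hsel _ _ _) fun _ => hg1 _ _ _ _ _
  have hreorder : (Ex PL fun u => Ex D.pX2 fun x =>
      Ex (piPmf fun _ : Ky => D.qH x) fun h => Ex D.pS fun s =>
      Ex (selKernel l₀ (D.pT s) D.qT Γ₁ u) fun l => Ex (D.pX1 (u l) s) fun x₁ =>
      Ex (D.W x₁ x s) fun y =>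
      Ex (selKernel k₀ (D.pH (D.π₂ y) x) (D.qH x) Γ₂ h) fun i => g u x h (D.π₃ y) i)
      = Ex D.pX2 fun x => Ex D.pS fun s => Ex PL fun u =>
        Ex (selKernel l₀ (D.pT s) D.qT Γ₁ u) fun l => c x s l u := by
    refine (Ex_comm _ _ _).trans (Ex_congr fun x => ?_)
    rw [Ex_comm D.pS]
    refine Ex_congr fun u => ?_
    refine (Ex_comm _ _ _).trans (Ex_congr fun s => ?_)
    refine (Ex_comm _ _ _).trans (Ex_congr fun l => ?_)
    refine (Ex_comm _ _ _).trans (Ex_congr fun x₁ => ?_)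
    exact Ex_comm _ _ _
  rw [hreorder]
  set e₁ : S → ℝ := fun s => Ex (D.pT s) fun t => ind (Γ₁ * D.qT t < D.pT s t) with he₁
  set e₂ : X₂ → Y → ℝ := fun x y =>
    Ex (D.pH (D.π₂ y) x) fun a => ind (Γ₂ * D.qH x a < D.pH (D.π₂ y) x a) with he₂
  have hstep₁ : ∀ x s, (Ex PL fun u => Ex (selKernel l₀ (D.pT s) D.qT Γ₁ u) fun l => c x s l u)
      ≤ 2 * (Ex (unif Ix) fun l => Ex PL fun u => Ex (D.pT s) fun t =>
          c x s l (Function.update u l t)) + 16 * Γ₁ / Fintype.card Ix + 4 * e₁ s := fun x s =>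
    covering l₀ hΓ₁ (D.hpT s) D.hqT (c x s) (hc0 x s) (hc1 x s)
  have hstep₂ : ∀ x s l u t, c x s l (Function.update u l t) ≤
      Ex (D.pX1 t s) fun x₁ => Ex (D.W x₁ x s) fun y =>
        2 * (Ex (unif Ky) fun i => Ex (piPmf fun _ : Ky => D.qH x) fun h =>
          Ex (D.pH (D.π₂ y) x) fun a => g (Function.update u l t) x (Function.update h i a)
            (D.π₃ y) i) + 16 * Γ₂ / Fintype.card Ky + 4 * e₂ x y := by
    intro x s l u t
    simp only [hc, Function.update_self]
    exact Ex_mono (D.hpX1 _ _).1 fun x₁ => Ex_mono (D.hW _ _ _).1 fun y =>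
      covering k₀ hΓ₂ (D.hpH _ _) (D.hqH _) (fun i h => g (Function.update u l t) x h (D.π₃ y) i)
        (fun _ _ => hg0 _ _ _ _ _) (fun _ _ => hg1 _ _ _ _ _)
  have hη₁' : (Ex D.pX2 fun _ => Ex D.pS e₁) ≤ η₁ := by
    simpa only [ideal, Ex_const (D.hpX1 _ _), Ex_const (D.hW _ _ _), Ex_const (D.hpH _ _)]
      using hη₁
  have hη₂' : (Ex D.pX2 fun x => Ex D.pS fun s => Ex (D.pT s) fun t => Ex (D.pX1 t s) fun x₁ =>
      Ex (D.W x₁ x s) fun y => e₂ x y) ≤ η₂ := hη₂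
  have hmain : (Ex D.pX2 fun x => Ex D.pS fun s => Ex (unif Ix) fun l => Ex PL fun u =>
      Ex (D.pT s) fun t => Ex (D.pX1 t s) fun x₁ => Ex (D.W x₁ x s) fun y =>
        Ex (unif Ky) fun i => Ex (piPmf fun _ : Ky => D.qH x) fun h =>
          Ex (D.pH (D.π₂ y) x) fun a => g (Function.update u l t) x (Function.update h i a)
            (D.π₃ y) i) ≤ B := by
    refine le_trans (le_of_eq ?_) (Ex_le_of_le isPmf_unif fun l =>
      Ex_le_of_le isPmf_unif fun i => hB l i)
    symm
    refine (Ex_congr fun l => ((Ex_comm _ _ _).trans (Ex_congr fun x => Ex_comm _ _ _))).trans ?_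
    refine (Ex_comm _ _ _).trans (Ex_congr fun x => ?_)
    refine (Ex_comm _ _ _).trans (Ex_congr fun s => ?_)
    refine Ex_congr fun l => ?_
    symm
    refine Eq.trans ?_ (Ex_comm _ _ _)
    refine (Ex_comm _ _ _).trans (Ex_congr fun t => ?_)
    refine Eq.trans ?_ (Ex_comm _ _ _)
    refine (Ex_comm _ _ _).trans (Ex_congr fun x₁ => ?_)
    refine Eq.trans ?_ (Ex_comm _ _ _)
    refine (Ex_comm _ _ _).trans (Ex_congr fun y => ?_)
    refine (Ex_comm _ _ _).trans (Ex_congr fun i => ?_)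
    refine Eq.trans ?_ (Ex_comm _ _ _)
    exact Ex_congr fun u => Ex_comm _ _ _
  calc _ ≤ Ex D.pX2 fun x => Ex D.pS fun s => 2 * (Ex (unif Ix) fun l => Ex PL fun u =>
        Ex (D.pT s) fun t => Ex (D.pX1 t s) fun x₁ => Ex (D.W x₁ x s) fun y =>
        2 * (Ex (unif Ky) fun i => Ex (piPmf fun _ : Ky => D.qH x) fun h =>
          Ex (D.pH (D.π₂ y) x) fun a => g (Function.update u l t) x (Function.update h i a)
            (D.π₃ y) i) + 16 * Γ₂ / Fintype.card Ky + 4 * e₂ x y)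
            + 16 * Γ₁ / Fintype.card Ix + 4 * e₁ s := by
        refine Ex_mono D.hpX2.1 fun x => Ex_mono D.hpS.1 fun s => (hstep₁ x s).trans ?_
        gcongr
        exact Ex_mono isPmf_unif.1 fun l => Ex_mono hPLpmf.1 fun u =>
          Ex_mono (D.hpT s).1 fun t => hstep₂ x s l u t
    _ ≤ _ := by
        simp only [Ex_add, Ex_mul_left, Ex_const D.hpX2, Ex_const D.hpS, Ex_const (D.hpT _),
          Ex_const hPLpmf, Ex_const isPmf_unif, Ex_const (D.hpX1 _ _), Ex_const (D.hW _ _ _)]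
          at hη₁' hη₂' hmain ⊢
        linarith

end OneBlock

end RelayModel

lemma epsilon_ne_imp {A : Type} [Nonempty A] {P : A → Prop} {a : A}
    (h : Classical.epsilon P ≠ a) : ¬P a ∨ ∃ a', a' ≠ a ∧ P a' := by
  by_cases ha : P a
  · exact Or.inr ⟨_, h, Classical.epsilon_spec ⟨a, ha⟩⟩
  · exact Or.inl ha

namespace RelayModel

variable {S T X₁ X₂ Y Y₂ Y₃ H : Type} [Fintype S] [Fintype T] [Fintype X₁]
  [Fintype X₂] [Fintype Y] [Fintype Y₂] [Fintype H] (D : RelayModel S T X₁ X₂ Y Y₂ Y₃ H)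

section RandomCode

variable {Ms Mo Ix Jx : Type} [Fintype Ms] [Fintype Mo] [Fintype Ix] [Fintype Jx]
  [DecidableEq Ms] [DecidableEq Mo] [DecidableEq Ix] [DecidableEq Jx]
  [Nonempty Ms] [Nonempty Mo] [Nonempty Ix] [Nonempty Jx]

/-- Distribution of a relay codeword together with its quantization codebook. -/
def cloudPmf (Ky : Type) [Fintype Ky] : X₂ × (Ky → H) → ℝ :=
  compPmf D.pX2 fun x => piPmf fun _ : Ky => D.qH x

lemma isPmf_cloudPmf (Ky : Type) [Fintype Ky] [DecidableEq Ky] : IsPmf (D.cloudPmf Ky) :=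
  isPmf_compPmf D.hpX2 fun x => isPmf_piPmf fun _ => D.hqH x

/-- The joint decoder over random codebooks fails. -/
def DecFail (A₁ : X₂ → Y₃ → Prop) (A₂ : X₂ → T → H → Y₃ → Prop)
    (τ : Ms → Ix → T) (χ : Mo → X₂ × (Mo × Jx → H)) (m : Mo) (w : Ms) (y : Y₃) (k : Mo) : Prop :=
  Classical.epsilon (fun m' => A₁ (χ m').1 y) ≠ m ∨
    Classical.epsilon (fun w' => ∃ l j, A₂ (χ m).1 (τ w' l) ((χ m).2 (k, j)) y) ≠ w

lemma ind_DecFail_le (A₁ : X₂ → Y₃ → Prop) (A₂ : X₂ → T → H → Y₃ → Prop)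
    (τ : Ms → Ix → T) (χ : Mo → X₂ × (Mo × Jx → H)) (m : Mo) (w : Ms) (y : Y₃)
    (u : Ix → T) (l : Ix) (t : T) (x : X₂) (h : Mo × Jx → H) (k : Mo) (j : Jx) (a : H) :
    ind (DecFail A₁ A₂ (Function.update τ w (Function.update u l t))
        (Function.update χ m (x, Function.update h (k, j) a)) m w y k)
      ≤ ind (¬A₁ x y) + ∑ m' ∈ univ.erase m, ind (A₁ (χ m').1 y) + ind (¬A₂ x t a y)
        + ∑ w' ∈ univ.erase w, ∑ l' : Ix, ind (A₂ x (τ w' l') a y)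
        + ∑ w' ∈ univ.erase w, ∑ l' : Ix, ∑ j' ∈ univ.erase j,
            ind (A₂ x (τ w' l') (h (k, j')) y) := by
  have n1 := ind_nonneg (¬A₁ x y)
  have n2 : 0 ≤ ∑ m' ∈ univ.erase m, ind (A₁ (χ m').1 y) :=
    sum_nonneg fun _ _ => ind_nonneg _
  have n3 := ind_nonneg (¬A₂ x t a y)
  have n4 : 0 ≤ ∑ w' ∈ univ.erase w, ∑ l' : Ix, ind (A₂ x (τ w' l') a y) :=
    sum_nonneg fun _ _ => sum_nonneg fun _ _ => ind_nonneg _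
  have n5 : 0 ≤ ∑ w' ∈ univ.erase w, ∑ l' : Ix, ∑ j' ∈ univ.erase j,
      ind (A₂ x (τ w' l') (h (k, j')) y) :=
    sum_nonneg fun _ _ => sum_nonneg fun _ _ => sum_nonneg fun _ _ => ind_nonneg _
  refine ind_le_of_imp (by linarith) fun hfail => ?_
  rcases hfail with hfail | hfail
  · rcases epsilon_ne_imp hfail with h1 | ⟨m', hm', h1⟩
    · rw [Function.update_self] at h1
      rw [ind_true h1]; linarith
    · rw [Function.update_of_ne hm'] at h1
      have : 1 ≤ ∑ m' ∈ univ.erase m, ind (A₁ (χ m').1 y) := by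
        rw [← ind_true h1]
        exact single_le_sum (f := fun m' => ind (A₁ (χ m').1 y)) (fun _ _ => ind_nonneg _)
          (mem_erase.2 ⟨hm', mem_univ _⟩)
      linarith
  · simp only [Function.update_self] at hfail
    rcases epsilon_ne_imp hfail with h1 | ⟨w', hw', l', j', h1⟩
    · have h2 : ¬A₂ x t a y := fun h2 => h1 ⟨l, j, by simpa using h2⟩
      rw [ind_true h2]; linarith
    · rw [Function.update_of_ne hw'] at h1
      by_cases hj : j' = j
      · subst hj
        rw [Function.update_self] at h1
        have : 1 ≤ ∑ w' ∈ univ.erase w, ∑ l' : Ix, ind (A₂ x (τ w' l') a y) := by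
          rw [← ind_true h1]
          refine le_trans ?_ (single_le_sum
            (f := fun w' => ∑ l' : Ix, ind (A₂ x (τ w' l') a y))
            (fun _ _ => sum_nonneg fun _ _ => ind_nonneg _) (mem_erase.2 ⟨hw', mem_univ _⟩))
          exact single_le_sum (f := fun l' => ind (A₂ x (τ w' l') a y))
            (fun _ _ => ind_nonneg _) (mem_univ _)
        linarith
      · rw [Function.update_of_ne (by simpa using hj)] at h1
        have : 1 ≤ ∑ w' ∈ univ.erase w, ∑ l' : Ix, ∑ j' ∈ univ.erase j,
            ind (A₂ x (τ w' l') (h (k, j')) y) := by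
          rw [← ind_true h1]
          refine le_trans ?_ (single_le_sum
            (f := fun w' => ∑ l' : Ix, ∑ j' ∈ univ.erase j, ind (A₂ x (τ w' l') (h (k, j')) y))
            (fun _ _ => sum_nonneg fun _ _ => sum_nonneg fun _ _ => ind_nonneg _)
            (mem_erase.2 ⟨hw', mem_univ _⟩))
          refine le_trans ?_ (single_le_sum
            (f := fun l' => ∑ j' ∈ univ.erase j, ind (A₂ x (τ w' l') (h (k, j')) y))
            (fun _ _ => sum_nonneg fun _ _ => ind_nonneg _) (mem_univ l'))
          exact single_le_sum (f := fun j' => ind (A₂ x (τ w' l') (h (k, j')) y))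
            (fun _ _ => ind_nonneg _) (mem_erase.2 ⟨hj, mem_univ _⟩)
        linarith

variable {A₁ : X₂ → Y₃ → Prop} {A₂ : X₂ → T → H → Y₃ → Prop}

lemma Ex_DecFail_le (m : Mo) (w : Ms) (y : Y₃) (l : Ix) (t : T) (x : X₂) (i : Mo × Jx) (a : H) :
    (Ex (piPmf fun _ : Ix => D.qT) fun u => Ex (piPmf fun _ : Mo × Jx => D.qH x) fun h =>
      Ex (piPmf fun _ : Ms => piPmf fun _ : Ix => D.qT) fun τ =>
      Ex (piPmf fun _ : Mo => D.cloudPmf (Mo × Jx)) fun χ =>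
        ind (DecFail A₁ A₂ (Function.update τ w (Function.update u l t))
          (Function.update χ m (x, Function.update h i a)) m w y i.1))
      ≤ ind (¬A₁ x y)
        + ((Fintype.card Mo : ℝ) - 1) * (Ex D.pX2 fun x' => ind (A₁ x' y)) + ind (¬A₂ x t a y)
        + ((Fintype.card Ms : ℝ) - 1) * Fintype.card Ix * (Ex D.qT fun t' => ind (A₂ x t' a y))
        + ((Fintype.card Ms : ℝ) - 1) * Fintype.card Ix * ((Fintype.card Jx : ℝ) - 1) *
          (Ex (D.qH x) fun a' => Ex D.qT fun t' => ind (A₂ x t' a' y)) := by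
  obtain ⟨k, j⟩ := i
  have hu : IsPmf (piPmf fun _ : Ix => D.qT) := isPmf_piPmf fun _ => D.hqT
  have hh : IsPmf (piPmf fun _ : Mo × Jx => D.qH x) := isPmf_piPmf fun _ => D.hqH x
  have hτ : IsPmf (piPmf fun _ : Ms => piPmf fun _ : Ix => D.qT) := isPmf_piPmf fun _ => hu
  have hχ : IsPmf (piPmf fun _ : Mo => D.cloudPmf (Mo × Jx)) :=
    isPmf_piPmf fun _ => D.isPmf_cloudPmf _
  refine (Ex_mono hu.1 fun u => Ex_mono hh.1 fun h => Ex_mono hτ.1 fun τ => Ex_mono hχ.1 fun χ =>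
    ind_DecFail_le A₁ A₂ τ χ m w y u l t x h k j a).trans (le_of_eq ?_)
  have e1 : ∀ m', (Ex (piPmf fun _ : Mo => D.cloudPmf (Mo × Jx)) fun χ => ind (A₁ (χ m').1 y))
      = Ex D.pX2 fun x' => ind (A₁ x' y) := fun m' => by
    rw [Ex_pi_eval (fun _ => D.isPmf_cloudPmf _) m' (fun d => ind (A₁ d.1 y)), cloudPmf,
      Ex_compPmf]
    exact Ex_congr fun x' => Ex_const (isPmf_piPmf (ι := Mo × Jx) fun _ => D.hqH x') (ind (A₁ x' y))
  have e2 : ∀ w' l' a', (Ex (piPmf fun _ : Ms => piPmf fun _ : Ix => D.qT)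
      fun τ => ind (A₂ x (τ w' l') a' y)) = Ex D.qT fun t' => ind (A₂ x t' a' y) :=
    fun w' l' a' => by
      rw [Ex_pi_eval (fun _ => hu) w' (fun u' => ind (A₂ x (u' l') a' y))]
      exact Ex_pi_eval (fun _ => D.hqT) l' (fun t' => ind (A₂ x t' a' y))
  have e3 : ∀ j', (Ex (piPmf fun _ : Mo × Jx => D.qH x) fun h => Ex D.qT fun t' =>
      ind (A₂ x t' (h (k, j')) y)) = Ex (D.qH x) fun a' => Ex D.qT fun t' => ind (A₂ x t' a' y) :=
    fun j' => Ex_pi_eval (fun _ => D.hqH x) (k, j')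
      (fun a' => Ex D.qT fun t' => ind (A₂ x t' a' y))
  have hcard : ∀ {A : Type} [Fintype A] [DecidableEq A] [Nonempty A] (b : A),
      (((univ : Finset A).erase b).card : ℝ) = (Fintype.card A : ℝ) - 1 := fun {A} _ _ _ b => by
    rw [card_erase_of_mem (mem_univ b), card_univ, Nat.cast_sub Fintype.card_pos, Nat.cast_one]
  simp only [Ex_add, Ex_sum, Ex_mul_left, Ex_const hu, Ex_const hh, Ex_const hτ, Ex_const hχ,
    e1, e2, e3, sum_const, hcard, nsmul_eq_mul, card_univ]
  ring

/-- Average performance of the random block code for fixed relay index and message. -/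
lemma random_code_bound (l₀ : Ix) (k₀ : Mo × Jx) {Γ₁ Γ₂ η₁ η₂ α₀ α₁ β₀ β₁ β₂ : ℝ}
    (hΓ₁ : 0 < Γ₁) (hΓ₂ : 0 < Γ₂)
    (hη₁ : D.ideal (fun s t _ _ _ _ => ind (Γ₁ * D.qT t < D.pT s t)) ≤ η₁)
    (hη₂ : D.ideal (fun _ _ _ x y a => ind (Γ₂ * D.qH x a < D.pH (D.π₂ y) x a)) ≤ η₂)
    (hα₀ : D.ideal (fun _ _ _ x y _ => ind (¬A₁ x (D.π₃ y))) ≤ α₀)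
    (hα₁ : D.ideal (fun _ _ _ _ y _ => Ex D.pX2 fun x' => ind (A₁ x' (D.π₃ y))) ≤ α₁)
    (hβ₀ : D.ideal (fun _ t _ x y a => ind (¬A₂ x t a (D.π₃ y))) ≤ β₀)
    (hβ₁ : D.ideal (fun _ _ _ x y a => Ex D.qT fun t' => ind (A₂ x t' a (D.π₃ y))) ≤ β₁)
    (hβ₂ : D.ideal (fun _ _ _ x y _ => Ex (D.qH x) fun a' => Ex D.qT fun t' =>
      ind (A₂ x t' a' (D.π₃ y))) ≤ β₂) (m : Mo) (w : Ms) :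
    (Ex (piPmf fun _ : Ms => piPmf fun _ : Ix => D.qT) fun τ =>
      Ex (piPmf fun _ : Mo => D.cloudPmf (Mo × Jx)) fun χ => Ex D.pS fun s =>
      Ex (selKernel l₀ (D.pT s) D.qT Γ₁ (τ w)) fun l => Ex (D.pX1 (τ w l) s) fun x₁ =>
      Ex (D.W x₁ (χ m).1 s) fun y =>
      Ex (selKernel k₀ (D.pH (D.π₂ y) (χ m).1) (D.qH (χ m).1) Γ₂ (χ m).2) fun i =>
        ind (DecFail A₁ A₂ τ χ m w (D.π₃ y) i.1))
    ≤ 4 * (α₀ + ((Fintype.card Mo : ℝ) - 1) * α₁ + β₀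
        + ((Fintype.card Ms : ℝ) - 1) * Fintype.card Ix * β₁
        + ((Fintype.card Ms : ℝ) - 1) * Fintype.card Ix * ((Fintype.card Jx : ℝ) - 1) * β₂)
      + 2 * (16 * Γ₂ / (Fintype.card Mo * Fintype.card Jx) + 4 * η₂)
      + 16 * Γ₁ / Fintype.card Ix + 4 * η₁ := by
  set PT := piPmf fun _ : Ms => piPmf fun _ : Ix => D.qT with hPT
  set PC := piPmf fun _ : Mo => D.cloudPmf (Mo × Jx) with hPC
  have hu : IsPmf (piPmf fun _ : Ix => D.qT) := isPmf_piPmf fun _ => D.hqT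
  have hτ : IsPmf PT := isPmf_piPmf fun _ => hu
  have hχ : IsPmf PC := isPmf_piPmf fun _ => D.isPmf_cloudPmf _
  set g : (Ix → T) → X₂ → (Mo × Jx → H) → Y₃ → Mo × Jx → ℝ := fun u x h y i =>
    Ex PT fun τ => Ex PC fun χ => ind (DecFail A₁ A₂ (Function.update τ w u)
      (Function.update χ m (x, h)) m w y i.1) with hg
  have hMo : (1 : ℝ) ≤ Fintype.card Mo := by exact_mod_cast Fintype.card_pos (α := Mo)
  have hMs : (1 : ℝ) ≤ Fintype.card Ms := by exact_mod_cast Fintype.card_pos (α := Ms)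
  have hJx : (1 : ℝ) ≤ Fintype.card Jx := by exact_mod_cast Fintype.card_pos (α := Jx)
  have key := D.double_covering l₀ k₀ hΓ₁ hΓ₂ hη₁ hη₂ g
    (B := α₀ + ((Fintype.card Mo : ℝ) - 1) * α₁ + β₀
        + ((Fintype.card Ms : ℝ) - 1) * Fintype.card Ix * β₁
        + ((Fintype.card Ms : ℝ) - 1) * Fintype.card Ix * ((Fintype.card Jx : ℝ) - 1) * β₂)
    (fun _ _ _ _ _ => Ex_nonneg hτ.1 fun _ => Ex_nonneg hχ.1 fun _ => ind_nonneg _)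
    (fun _ _ _ _ _ => Ex_le_of_le hτ fun _ => Ex_le_of_le hχ fun _ => ind_le_one _)
    (fun l i => by
      refine (D.ideal_mono fun s t x₁ x y a =>
        D.Ex_DecFail_le (A₁ := A₁) (A₂ := A₂) m w (D.π₃ y) l t x i a).trans ?_
      rw [ideal_add, ideal_add, ideal_add, ideal_add, ideal_mul_left, ideal_mul_left,
        ideal_mul_left]
      have h1 : 0 ≤ (Fintype.card Mo : ℝ) - 1 := by linarith
      have h2 : 0 ≤ (Fintype.card Ms : ℝ) - 1 := by linarith
      have h3 : 0 ≤ (Fintype.card Jx : ℝ) - 1 := by linarith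
      gcongr)
  rw [Fintype.card_prod, Nat.cast_mul] at key
  refine le_trans (le_of_eq ?_) key
  rw [Ex_pi_resample w hu]
  refine Eq.trans (Ex_comm _ _ _) (Ex_congr fun u => ?_)
  rw [← Ex_compPmf D.pX2 (fun x => piPmf fun _ : Mo × Jx => D.qH x)
    (fun d => Ex D.pS fun s => Ex (selKernel l₀ (D.pT s) D.qT Γ₁ u) fun l =>
      Ex (D.pX1 (u l) s) fun x₁ => Ex (D.W x₁ d.1 s) fun y =>
      Ex (selKernel k₀ (D.pH (D.π₂ y) d.1) (D.qH d.1) Γ₂ d.2) fun i => g u d.1 d.2 (D.π₃ y) i)]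
  simp only [Function.update_self]
  have : ∀ τ, _ = _ := fun τ : Ms → Ix → T =>
    Ex_pi_resample (p := fun _ : Mo => D.cloudPmf (Mo × Jx)) m (D.isPmf_cloudPmf _)
      (fun χ => Ex D.pS fun s =>
        Ex (selKernel l₀ (D.pT s) D.qT Γ₁ u) fun l => Ex (D.pX1 (u l) s) fun x₁ =>
        Ex (D.W x₁ (χ m).1 s) fun y =>
        Ex (selKernel k₀ (D.pH (D.π₂ y) (χ m).1) (D.qH (χ m).1) Γ₂ (χ m).2) fun i =>
        ind (DecFail A₁ A₂ (Function.update τ w u) χ m w (D.π₃ y) i.1))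
  refine (Ex_congr this).trans ?_
  simp only [Function.update_self]
  refine (Ex_congr fun τ => Ex_comm _ _ _).trans ?_
  refine (Ex_comm _ _ _).trans (Ex_congr fun d => ?_)
  refine (Ex_congr fun τ => Ex_comm _ _ _).trans ((Ex_comm _ _ _).trans (Ex_congr fun s => ?_))
  refine (Ex_congr fun τ => Ex_comm _ _ _).trans ((Ex_comm _ _ _).trans (Ex_congr fun l => ?_))
  refine (Ex_congr fun τ => Ex_comm _ _ _).trans ((Ex_comm _ _ _).trans (Ex_congr fun x₁ => ?_))
  refine (Ex_congr fun τ => Ex_comm _ _ _).trans ((Ex_comm _ _ _).trans (Ex_congr fun y => ?_))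
  exact (Ex_congr fun τ => Ex_comm _ _ _).trans (Ex_comm _ _ _)

/-- For every prior on relay indices and messages there is a block code with small error. -/
theorem exists_blockCode {Γ₁ Γ₂ η₁ η₂ α₀ α₁ β₀ β₁ β₂ : ℝ}
    (Ix Jx : Type) [Fintype Ix] [Fintype Jx] [DecidableEq Ix] [DecidableEq Jx]
    [Nonempty Ix] [Nonempty Jx] [DecidableEq S] [DecidableEq Y₂]
    (hΓ₁ : 0 < Γ₁) (hΓ₂ : 0 < Γ₂)
    (hη₁ : D.ideal (fun s t _ _ _ _ => ind (Γ₁ * D.qT t < D.pT s t)) ≤ η₁)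
    (hη₂ : D.ideal (fun _ _ _ x y a => ind (Γ₂ * D.qH x a < D.pH (D.π₂ y) x a)) ≤ η₂)
    (hα₀ : D.ideal (fun _ _ _ x y _ => ind (¬A₁ x (D.π₃ y))) ≤ α₀)
    (hα₁ : D.ideal (fun _ _ _ _ y _ => Ex D.pX2 fun x' => ind (A₁ x' (D.π₃ y))) ≤ α₁)
    (hβ₀ : D.ideal (fun _ t _ x y a => ind (¬A₂ x t a (D.π₃ y))) ≤ β₀)
    (hβ₁ : D.ideal (fun _ _ _ x y a => Ex D.qT fun t' => ind (A₂ x t' a (D.π₃ y))) ≤ β₁)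
    (hβ₂ : D.ideal (fun _ _ _ x y _ => Ex (D.qH x) fun a' => Ex D.qT fun t' =>
      ind (A₂ x t' a' (D.π₃ y))) ≤ β₂) {ε : ℝ}
    (hε : 4 * (α₀ + ((Fintype.card Mo : ℝ) - 1) * α₁ + β₀
        + ((Fintype.card Ms : ℝ) - 1) * Fintype.card Ix * β₁
        + ((Fintype.card Ms : ℝ) - 1) * Fintype.card Ix * ((Fintype.card Jx : ℝ) - 1) * β₂)
      + 2 * (16 * Γ₂ / (Fintype.card Mo * Fintype.card Jx) + 4 * η₂)
      + 16 * Γ₁ / Fintype.card Ix + 4 * η₁ ≤ ε)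
    {Q : Mo × Ms → ℝ} (hQ : IsPmf Q) :
    ∃ C : BlockCode S X₁ X₂ Y₂ Y₃ Mo Ms, Ex Q (fun x => D.blockErr C x.1 x.2) ≤ ε := by
  obtain ⟨l₀⟩ := ‹Nonempty Ix›
  obtain ⟨m₀⟩ := ‹Nonempty Mo›
  obtain ⟨j₀⟩ := ‹Nonempty Jx›
  have : Nonempty Ix := ⟨l₀⟩
  have : Nonempty Mo := ⟨m₀⟩
  have : Nonempty Jx := ⟨j₀⟩
  set PT := piPmf fun _ : Ms => piPmf fun _ : Ix => D.qT with hPT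
  set PC := piPmf fun _ : Mo => D.cloudPmf (Mo × Jx) with hPC
  have hτ : IsPmf PT := isPmf_piPmf fun _ => isPmf_piPmf fun _ => D.hqT
  have hχ : IsPmf PC := isPmf_piPmf fun _ => D.isPmf_cloudPmf _
  set kE : (Ms → Ix → T) → Ms × S → Ix × X₁ → ℝ := fun τ x =>
    compPmf (selKernel l₀ (D.pT x.2) D.qT Γ₁ (τ x.1)) (fun l => D.pX1 (τ x.1 l) x.2) with hkE
  set kR : (Mo → X₂ × (Mo × Jx → H)) → Mo × Y₂ → Mo × Jx → ℝ := fun χ x =>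
    selKernel (m₀, j₀) (D.pH x.2 (χ x.1).1) (D.qH (χ x.1).1) Γ₂ (χ x.1).2 with hkR
  have hkE' : ∀ τ x, IsPmf (kE τ x) := fun τ x =>
    isPmf_compPmf (selKernel_isPmf _ (D.hpT _) D.hqT _) fun l => D.hpX1 _ _
  have hkR' : ∀ χ x, IsPmf (kR χ x) := fun χ x => selKernel_isPmf _ (D.hpH _ _) (D.hqH _) _
  let C : (Ms → Ix → T) → (Mo → X₂ × (Mo × Jx → H)) → (Ms × S → Ix × X₁) →
      (Mo × Y₂ → Mo × Jx) → BlockCode S X₁ X₂ Y₂ Y₃ Mo Ms := fun τ χ e r =>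
    { enc := fun w s => (e (w, s)).2
      word := fun m => (χ m).1
      quant := fun m y => (r (m, y)).1
      decBin := fun y => Classical.epsilon (fun m' => A₁ (χ m').1 y)
      decMsg := fun m k y =>
        Classical.epsilon (fun w' => ∃ l j, A₂ (χ m).1 (τ w' l) ((χ m).2 (k, j)) y) }
  have havg : ∀ τ χ m w, (Ex (piPmf (kE τ)) fun e => Ex (piPmf (kR χ)) fun r =>
      D.blockErr (C τ χ e r) m w) = Ex D.pS fun s =>
      Ex (selKernel l₀ (D.pT s) D.qT Γ₁ (τ w)) fun l => Ex (D.pX1 (τ w l) s) fun x₁ =>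
      Ex (D.W x₁ (χ m).1 s) fun y =>
      Ex (selKernel (m₀, j₀) (D.pH (D.π₂ y) (χ m).1) (D.qH (χ m).1) Γ₂ (χ m).2) fun i =>
        ind (DecFail A₁ A₂ τ χ m w (D.π₃ y) i.1) := by
    intro τ χ m w
    have h1 : ∀ e, (Ex (piPmf (kR χ)) fun r => D.blockErr (C τ χ e r) m w)
        = Ex D.pS fun s => Ex (D.W (e (w, s)).2 (χ m).1 s) fun y =>
          Ex (kR χ (m, D.π₂ y)) fun i => ind (DecFail A₁ A₂ τ χ m w (D.π₃ y) i.1) := by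
      intro e
      refine (Ex_comm (piPmf (kR χ)) D.pS fun r s => Ex (D.W (e (w, s)).2 (χ m).1 s) fun y =>
        ind ((C τ χ e r).Bad m w (D.π₂ y) (D.π₃ y))).trans (Ex_congr fun s => ?_)
      refine (Ex_comm _ _ _).trans (Ex_congr fun y => ?_)
      exact Ex_pi_eval (hkR' χ) (m, D.π₂ y)
        (fun i => ind (DecFail A₁ A₂ τ χ m w (D.π₃ y) i.1))
    refine (Ex_congr h1).trans ((Ex_comm _ _ _).trans (Ex_congr fun s => ?_))
    rw [Ex_pi_eval (hkE' τ) (w, s) (fun e => Ex (D.W e.2 (χ m).1 s) fun y =>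
          Ex (kR χ (m, D.π₂ y)) fun i => ind (DecFail A₁ A₂ τ χ m w (D.π₃ y) i.1)), hkE,
      Ex_compPmf]
  have htotal : (Ex PT fun τ => Ex PC fun χ => Ex (piPmf (kE τ)) fun e => Ex (piPmf (kR χ)) fun r =>
      Ex Q fun x => D.blockErr (C τ χ e r) x.1 x.2) ≤ ε := by
    have : (Ex PT fun τ => Ex PC fun χ => Ex (piPmf (kE τ)) fun e => Ex (piPmf (kR χ)) fun r =>
      Ex Q fun x => D.blockErr (C τ χ e r) x.1 x.2) = Ex Q fun x => Ex PT fun τ => Ex PC fun χ =>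
        Ex (piPmf (kE τ)) fun e => Ex (piPmf (kR χ)) fun r => D.blockErr (C τ χ e r) x.1 x.2 := by
      rw [Ex_comm Q]
      refine Ex_congr fun τ => ?_
      rw [Ex_comm Q]
      refine Ex_congr fun χ => ?_
      rw [Ex_comm Q]
      refine Ex_congr fun e => ?_
      rw [Ex_comm Q]
    rw [this]
    refine Ex_le_of_le hQ fun x => ?_
    refine le_trans (le_of_eq (Ex_congr fun τ => Ex_congr fun χ => havg τ χ x.1 x.2)) ?_
    exact (D.random_code_bound l₀ (m₀, j₀) hΓ₁ hΓ₂ hη₁ hη₂ hα₀ hα₁ hβ₀ hβ₁ hβ₂ x.1 x.2).trans hε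
  obtain ⟨τ, h1⟩ := exists_le_Ex hτ htotal
  obtain ⟨χ, h2⟩ := exists_le_Ex hχ h1
  obtain ⟨e, h3⟩ := exists_le_Ex (isPmf_piPmf (hkE' τ)) h2
  obtain ⟨r, h4⟩ := exists_le_Ex (isPmf_piPmf (hkR' χ)) h3
  exact ⟨C τ χ e r, h4⟩

end RandomCode

end RelayModel

/-! ### Concatenation of blocks -/

/-- States visited by the recursion `m ↦ f i m (z i)` started at `m`. -/
def stateAt {M Z : Type} : (N : ℕ) → (ℕ → M → Z → M) → M → (Fin N → Z) → Fin (N + 1) → M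
  | 0, _, m, _ => fun _ => m
  | N + 1, f, m, z =>
    Fin.cons m (stateAt N (fun b => f (b + 1)) (f 0 m (z 0)) (fun i => z i.succ))

lemma stateAt_zero {M Z : Type} (N : ℕ) (f : ℕ → M → Z → M) (m : M) (z : Fin N → Z) :
    stateAt N f m z 0 = m := by
  cases N <;> rfl

lemma stateAt_succ {M Z : Type} (N : ℕ) (f : ℕ → M → Z → M) (m : M) (z : Fin N → Z) (i : Fin N) :
    stateAt N f m z i.succ = f i (stateAt N f m z i.castSucc) (z i) := by
  induction N generalizing f m with
  | zero => exact i.elim0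
  | succ N ih =>
    refine Fin.cases ?_ (fun j => ?_) i
    · simp only [stateAt, Fin.cons_succ, stateAt_zero, Fin.castSucc_zero, Fin.cons_zero,
        Fin.val_zero]
    · simp only [stateAt, Fin.cons_succ, Fin.castSucc_succ, Fin.val_succ]
      exact ih _ _ _ j

lemma stateAt_causal {M Z : Type} (N : ℕ) (f : ℕ → M → Z → M) (m : M) (z z' : Fin N → Z)
    (k : Fin (N + 1)) (h : ∀ i : Fin N, (i : ℕ) < k → z i = z' i) :
    stateAt N f m z k = stateAt N f m z' k := by
  induction N generalizing f m with
  | zero => rfl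
  | succ N ih =>
    revert h
    refine Fin.cases (fun _ => ?_) (fun j h => ?_) k
    · rfl
    · simp only [stateAt, Fin.cons_succ]
      rw [h 0 (by simp)]
      exact ih _ _ _ _ j fun i hi => h i.succ (by simpa using hi)

/-- Total expected cost of a controlled chain is bounded by summing the costs per step. -/
lemma chain_bound {M Z : Type} [Fintype M] [Fintype Z] (N : ℕ) {κ : ℕ → M → Z → ℝ}
    {f : ℕ → M → Z → M} {c : ℕ → M → Z → ℝ} {q : ℕ → M → ℝ} {ε : ℝ}
    (hκ : ∀ b m, IsPmf (κ b m))
    (hstep : ∀ b g, Ex (q (b + 1)) g = Ex (q b) fun m => Ex (κ b m) fun z => g (f b m z))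
    (hc : ∀ b, Ex (q b) (fun m => Ex (κ b m) (c b m)) ≤ ε) :
    Ex (q 0) (fun m => ∑ z : Fin N → Z, (∏ i : Fin N, κ i (stateAt N f m z i.castSucc) (z i)) *
      ∑ i : Fin N, c i (stateAt N f m z i.castSucc) (z i)) ≤ N * ε := by
  have hmass : ∀ (N : ℕ) (κ : ℕ → M → Z → ℝ) (f : ℕ → M → Z → M) (m : M),
      (∀ b m, IsPmf (κ b m)) →
      ∑ z : Fin N → Z, ∏ i : Fin N, κ i (stateAt N f m z i.castSucc) (z i) = 1 := by
    intro N
    induction N with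
    | zero => intros; simp
    | succ N ih =>
      intro κ f m hκ
      rw [← Equiv.sum_comp (Fin.consEquiv fun _ : Fin (N + 1) => Z), Fintype.sum_prod_type]
      simp only [Fin.consEquiv, Equiv.coe_fn_mk, stateAt, Fin.prod_univ_succ, Fin.cons_zero,
        Fin.cons_succ, Fin.castSucc_zero, Fin.castSucc_succ, Fin.val_zero, Fin.val_succ,
        ← Finset.mul_sum]
      have := fun z₀ => ih (fun b => κ (b + 1)) (fun b => f (b + 1)) (f 0 m z₀)
        fun b => hκ (b + 1)
      simp only [this, mul_one, (hκ 0 m).2]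
  induction N generalizing κ f c q with
  | zero => simp [Ex]
  | succ N ih =>
    have hV : ∀ m, ∑ z : Fin (N + 1) → Z,
        (∏ i : Fin (N + 1), κ i (stateAt (N + 1) f m z i.castSucc) (z i)) *
          ∑ i : Fin (N + 1), c i (stateAt (N + 1) f m z i.castSucc) (z i)
        = Ex (κ 0 m) (c 0 m) + Ex (κ 0 m) fun z₀ => ∑ z : Fin N → Z,
          (∏ i : Fin N, κ (i + 1) (stateAt N (fun b => f (b + 1)) (f 0 m z₀) z i.castSucc) (z i)) *
          ∑ i : Fin N, c (i + 1) (stateAt N (fun b => f (b + 1)) (f 0 m z₀) z i.castSucc)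
            (z i) := by
      intro m
      rw [← Equiv.sum_comp (Fin.consEquiv fun _ : Fin (N + 1) => Z), Fintype.sum_prod_type,
        ← Ex_add]
      simp only [Fin.consEquiv, Equiv.coe_fn_mk, stateAt, Fin.prod_univ_succ, Fin.sum_univ_succ,
        Fin.cons_zero, Fin.cons_succ, Fin.castSucc_zero, Fin.castSucc_succ, Fin.val_zero,
        Fin.val_succ, mul_add, Finset.sum_add_distrib, Ex]
      have := fun z₀ => hmass N (fun b => κ (b + 1)) (fun b => f (b + 1)) (f 0 m z₀)
        fun b => hκ (b + 1)
      simp only [← Finset.sum_mul, ← Finset.mul_sum, this, one_mul, mul_assoc]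
    simp only [hV, Ex_add]
    have h1 := ih (κ := fun b => κ (b + 1)) (f := fun b => f (b + 1)) (c := fun b => c (b + 1))
      (q := fun b => q (b + 1)) (fun b => hκ (b + 1)) (fun b => hstep (b + 1))
      (fun b => hc (b + 1))
    simp only [Nat.zero_add] at h1
    rw [hstep 0] at h1
    push_cast
    linarith [hc 0]

namespace RelayModel

variable {S T X₁ X₂ Y Y₂ Y₃ H : Type} [Fintype S] [Fintype T] [Fintype X₁]
  [Fintype X₂] [Fintype Y] [Fintype H] (D : RelayModel S T X₁ X₂ Y Y₂ Y₃ H)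
  {Ms Mo : Type} [Fintype Ms] [Fintype Mo] [Nonempty Ms]

/-- Law of message, state and channel output in one block, given the relay index. -/
def blockLaw (C : BlockCode S X₁ X₂ Y₂ Y₃ Mo Ms) (m : Mo) : Ms × S × Y → ℝ :=
  compPmf (unif Ms) fun w => compPmf D.pS fun s => D.W (C.enc w s) (C.word m) s

lemma isPmf_blockLaw (C : BlockCode S X₁ X₂ Y₂ Y₃ Mo Ms) (m : Mo) : IsPmf (D.blockLaw C m) :=
  isPmf_compPmf isPmf_unif fun _ => isPmf_compPmf D.hpS fun _ => D.hW _ _ _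

lemma Ex_blockLaw (C : BlockCode S X₁ X₂ Y₂ Y₃ Mo Ms) (m : Mo) (F : Ms × S × Y → ℝ) :
    Ex (D.blockLaw C m) F = Ex (unif Ms) fun w => Ex D.pS fun s =>
      Ex (D.W (C.enc w s) (C.word m) s) fun y => F (w, s, y) := by
  simp only [blockLaw, Ex_compPmf]

/-- Codes chosen greedily for the successive laws of the relay index. -/
lemma exists_codes {ε : ℝ}
    (hex : ∀ Q : Mo × Ms → ℝ, IsPmf Q →
      ∃ C : BlockCode S X₁ X₂ Y₂ Y₃ Mo Ms, Ex Q (fun x => D.blockErr C x.1 x.2) ≤ ε) (m₀ : Mo) :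
    ∃ (C : ℕ → BlockCode S X₁ X₂ Y₂ Y₃ Mo Ms) (q : ℕ → Mo → ℝ),
      (∀ g, Ex (q 0) g = g m₀) ∧
      (∀ b g, Ex (q (b + 1)) g = Ex (q b) fun m => Ex (D.blockLaw (C b) m) fun z =>
        g ((C b).quant m (D.π₂ z.2.2))) ∧
      ∀ b, Ex (q b) (fun m => Ex (D.blockLaw (C b) m) fun z =>
        ind ((C b).Bad m z.1 (D.π₂ z.2.2) (D.π₃ z.2.2))) ≤ ε := by
  have hstep : ∀ q : {q : Mo → ℝ // IsPmf q}, ∃ (C : BlockCode S X₁ X₂ Y₂ Y₃ Mo Ms)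
      (q' : {q : Mo → ℝ // IsPmf q}),
      (∀ g, Ex q'.1 g = Ex q.1 fun m => Ex (D.blockLaw C m) fun z =>
        g (C.quant m (D.π₂ z.2.2))) ∧
      Ex q.1 (fun m => Ex (D.blockLaw C m) fun z =>
        ind (C.Bad m z.1 (D.π₂ z.2.2) (D.π₃ z.2.2))) ≤ ε := by
    rintro ⟨q, hq⟩
    obtain ⟨C, hC⟩ := hex (compPmf q fun _ => unif Ms) (isPmf_compPmf hq fun _ => isPmf_unif)
    have hg : ∀ g : Mo → ℝ, Ex (fun m' => Ex q fun m => Ex (D.blockLaw C m) fun z =>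
        if C.quant m (D.π₂ z.2.2) = m' then 1 else 0) g
        = Ex q fun m => Ex (D.blockLaw C m) fun z => g (C.quant m (D.π₂ z.2.2)) := by
      intro g
      have : ∀ m', (Ex q fun m => Ex (D.blockLaw C m) fun z =>
          if C.quant m (D.π₂ z.2.2) = m' then (1 : ℝ) else 0) * g m'
          = Ex q fun m => Ex (D.blockLaw C m) fun z =>
            g m' * if C.quant m (D.π₂ z.2.2) = m' then (1 : ℝ) else 0 := fun m' => by
        rw [mul_comm, ← Ex_mul_left]
        simp only [Ex_mul_left]
      rw [Ex]
      simp only [this]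
      rw [← Ex_sum]
      refine Ex_congr fun m => ?_
      rw [← Ex_sum]
      exact Ex_congr fun z => by simp
    refine ⟨C, ⟨fun m' => Ex q fun m => Ex (D.blockLaw C m) fun z =>
      if C.quant m (D.π₂ z.2.2) = m' then 1 else 0, ⟨fun m' => ?_, ?_⟩⟩, hg, ?_⟩
    · exact Ex_nonneg hq.1 fun m => Ex_nonneg (D.isPmf_blockLaw C m).1 fun z => by
        split_ifs <;> norm_num
    · have := hg fun _ => 1
      rw [Ex_congr fun m => Ex_const (D.isPmf_blockLaw C m) 1, Ex_const hq] at this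
      rw [Ex] at this
      simpa only [mul_one] using this
    · simpa only [Ex_compPmf, Ex_blockLaw, blockErr] using hC
  choose nextC nextq h1 h2 using hstep
  have hδ : IsPmf fun m : Mo => if m = m₀ then (1 : ℝ) else 0 :=
    ⟨fun m => by dsimp only; split_ifs <;> norm_num, by simp⟩
  let Q : ℕ → {q : Mo → ℝ // IsPmf q} := fun b => Nat.rec ⟨_, hδ⟩ (fun _ q => nextq q) b
  exact ⟨fun b => nextC (Q b), fun b => (Q b).1, fun g => by simp [Q, Ex],
    fun b g => h1 (Q b) g, fun b => h2 (Q b)⟩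

end RelayModel

lemma stateAt_comp {M Z Z' : Type} (N : ℕ) (f : ℕ → M → Z' → M) (g : Z → Z') (m : M)
    (z : Fin N → Z) :
    stateAt N (fun b m z => f b m (g z)) m z = stateAt N f m (fun i => g (z i)) := by
  induction N generalizing f m with
  | zero => rfl
  | succ N ih => simp only [stateAt, ih]

lemma Ex_unif_snoc {A : Type} [Fintype A] (N : ℕ) (F : (Fin (N + 1) → A) → ℝ) :
    Ex (unif (Fin (N + 1) → A)) F
      = Ex (unif A) fun a => Ex (unif (Fin N → A)) fun w => F (Fin.snoc (α := fun _ => A) w a) := by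
  simp only [Ex, unif, Fintype.card_pi, prod_const, card_univ, Fintype.card_fin, Finset.mul_sum]
  rw [← Equiv.sum_comp (Fin.snocEquiv fun _ : Fin (N + 1) => A), Fintype.sum_prod_type]
  refine sum_congr rfl fun a _ => sum_congr rfl fun w _ => ?_
  simp only [Fin.snocEquiv, Equiv.coe_fn_mk]
  rw [pow_succ]
  push_cast
  rw [mul_inv]
  ring

namespace RelayModel

section MultiBlock

variable {S T X₁ X₂ Y Y₂ Y₃ H : Type} [Fintype S] [Fintype T] [Fintype X₁]
  [Fintype X₂] [Fintype Y] [Fintype H] (D : RelayModel S T X₁ X₂ Y Y₂ Y₃ H)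
  {Ms Mo : Type} [Fintype Ms] [Fintype Mo] [Nonempty Ms]

/-- Relay indices along the blocks. -/
def relayIdx (C : ℕ → BlockCode S X₁ X₂ Y₂ Y₃ Mo Ms) (N : ℕ) (m₀ : Mo) (y : Fin N → Y₂) :
    Fin (N + 1) → Mo :=
  stateAt N (fun b => (C b).quant) m₀ y

/-- Decoded messages of all blocks but the last. -/
def decodeAll (C : ℕ → BlockCode S X₁ X₂ Y₂ Y₃ Mo Ms) (B : ℕ) (y : Fin (B + 1) → Y₃) (b : Fin B) :
    Ms :=
  (C b).decMsg ((C b).decBin (y b.castSucc)) ((C (b + 1)).decBin (y b.succ)) (y b.castSucc)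

lemma exists_bad_of_decodeAll_ne (C : ℕ → BlockCode S X₁ X₂ Y₂ Y₃ Mo Ms) (B : ℕ) (m₀ : Mo)
    (y₂ : Fin (B + 1) → Y₂) (y₃ : Fin (B + 1) → Y₃) (w : Fin (B + 1) → Ms)
    (h : decodeAll C B y₃ ≠ fun b => w b.castSucc) :
    ∃ i : Fin (B + 1), (C i).Bad (relayIdx C (B + 1) m₀ y₂ i.castSucc) (w i) (y₂ i) (y₃ i) := by
  by_contra! hbad
  refine h (funext fun b => ?_)
  have h1 := hbad b.castSucc
  have h2 := hbad b.succ
  simp only [BlockCode.Bad, not_or, not_not] at h1 h2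
  have h3 : relayIdx C (B + 1) m₀ y₂ b.succ.castSucc
      = (C b).quant (relayIdx C (B + 1) m₀ y₂ b.castSucc.castSucc) (y₂ b.castSucc) := by
    rw [← Fin.succ_castSucc]
    exact stateAt_succ _ _ _ _ b.castSucc
  have h4 : (C b).decBin (y₃ b.castSucc) = relayIdx C (B + 1) m₀ y₂ b.castSucc.castSucc := h1.1
  have h5 : (C (b + 1)).decBin (y₃ b.succ) = relayIdx C (B + 1) m₀ y₂ b.succ.castSucc := h2.1
  rw [decodeAll, h4, h5, h3]
  exact h1.2

/-- Block-Markov coding: the error probability is at most the number of blocks times the error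
probability of one block. -/
lemma exists_multiBlock {ε : ℝ}
    (hex : ∀ Q : Mo × Ms → ℝ, IsPmf Q →
      ∃ C : BlockCode S X₁ X₂ Y₂ Y₃ Mo Ms, Ex Q (fun x => D.blockErr C x.1 x.2) ≤ ε)
    (m₀ : Mo) (B : ℕ) :
    ∃ (C : ℕ → BlockCode S X₁ X₂ Y₂ Y₃ Mo Ms) (w₀ : Ms),
      Ex (unif (Fin B → Ms)) (fun w => ∑ s : Fin (B + 1) → S, ∑ y : Fin (B + 1) → Y,
        ((∏ i, D.pS (s i)) * ∏ i : Fin (B + 1),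
          D.W ((C i).enc (Fin.snoc (α := fun _ => Ms) w w₀ i) (s i))
            ((C i).word (relayIdx C (B + 1) m₀ (fun i => D.π₂ (y i)) i.castSucc)) (s i) (y i))
          * ind (decodeAll C B (fun i => D.π₃ (y i)) ≠ w)) ≤ (B + 1 : ℕ) * ε := by
  obtain ⟨C, q, hq0, hq, hc⟩ := D.exists_codes hex m₀
  refine ⟨C, ?_⟩
  have hchain := chain_bound (B + 1) (κ := fun b => D.blockLaw (C b))
    (f := fun b m z => (C b).quant m (D.π₂ z.2.2))
    (c := fun b m z => ind ((C b).Bad m z.1 (D.π₂ z.2.2) (D.π₃ z.2.2)))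
    (fun b => D.isPmf_blockLaw (C b)) hq hc
  rw [hq0] at hchain
  refine exists_le_Ex (isPmf_unif (ι := Ms)) ?_
  have hsnoc := Ex_unif_snoc B (fun w : Fin (B + 1) → Ms =>
    ∑ s : Fin (B + 1) → S, ∑ y : Fin (B + 1) → Y,
        ((∏ i, D.pS (s i)) * ∏ i : Fin (B + 1), D.W ((C i).enc (w i) (s i))
            ((C i).word (relayIdx C (B + 1) m₀ (fun i => D.π₂ (y i)) i.castSucc)) (s i) (y i))
          * ind (decodeAll C B (fun i => D.π₃ (y i)) ≠ fun b => w b.castSucc))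
  simp only [Fin.snoc_castSucc] at hsnoc
  rw [← hsnoc]
  refine le_trans ?_ hchain
  rw [← Equiv.sum_comp (Equiv.arrowProdEquivProdArrow (Fin (B + 1)) (fun _ => Ms)
    (fun _ => S × Y)).symm, Fintype.sum_prod_type]
  refine sum_le_sum fun w _ => ?_
  rw [← Equiv.sum_comp (Equiv.arrowProdEquivProdArrow (Fin (B + 1)) (fun _ => S)
    (fun _ => Y)).symm, Fintype.sum_prod_type, Finset.mul_sum]
  refine sum_le_sum fun s _ => ?_
  rw [Finset.mul_sum]
  refine sum_le_sum fun y _ => ?_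
  simp only [Equiv.arrowProdEquivProdArrow, Equiv.coe_fn_symm_mk, blockLaw, compPmf,
    prod_mul_distrib, unif, prod_const, card_univ, Fintype.card_fin, Fintype.card_pi]
  rw [stateAt_comp (B + 1) (fun b => (C b).quant) (fun z : Ms × S × Y => D.π₂ z.2.2)]
  rw [Nat.cast_pow, ← inv_pow, ← mul_assoc]
  refine mul_le_mul_of_nonneg_left ?_ (mul_nonneg (by positivity)
    (mul_nonneg (prod_nonneg fun i _ => D.hpS.1 _) (prod_nonneg fun i _ => (D.hW _ _ _).1 _)))
  refine ind_le_of_imp (sum_nonneg fun _ _ => ind_nonneg _) fun h => ?_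
  obtain ⟨i, hi⟩ := exists_bad_of_decodeAll_ne C B m₀ (fun i => D.π₂ (y i)) _ w h
  rw [← ind_true hi]
  exact single_le_sum (f := fun i : Fin (B + 1) => ind ((C i).Bad
    (relayIdx C (B + 1) m₀ (fun i => D.π₂ (y i)) i.castSucc) (w i) (D.π₂ (y i)) (D.π₃ (y i))))
    (fun _ _ => ind_nonneg _) (mem_univ i)

end MultiBlock

section Flatten

variable {𝒳₁ 𝒳₂ 𝒴₂ 𝒴₃ 𝒮 T H : Type} [Fintype 𝒳₁] [Fintype 𝒳₂] [Fintype 𝒴₂]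
  [Fintype 𝒴₃] [Fintype 𝒮] [Fintype T] [Fintype H]

/-- Sequences of length `a * n` as sequences of `a` blocks of length `n`. -/
def blocksEquiv (a n : ℕ) (A : Type) : (Fin a → Fin n → A) ≃ (Fin (a * n) → A) :=
  (Equiv.curry _ _ _).symm.trans (Equiv.arrowCongr finProdFinEquiv (Equiv.refl A))

lemma blocksEquiv_apply {a n : ℕ} {A : Type} (x : Fin a → Fin n → A) (b : Fin a) (j : Fin n) :
    blocksEquiv a n A x (finProdFinEquiv (b, j)) = x b j := by
  simp [blocksEquiv, Equiv.arrowCongr]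

lemma blocksEquiv_comp {a n : ℕ} {A A' : Type} (g : A → A') (x : Fin a → Fin n → A) :
    (fun k => g (blocksEquiv a n A x k)) = blocksEquiv a n A' fun b j => g (x b j) := by
  funext k
  obtain ⟨⟨b, j⟩, rfl⟩ := finProdFinEquiv.surjective k
  rw [blocksEquiv_apply, blocksEquiv_apply]

lemma prod_blocks {a n : ℕ} (g : Fin (a * n) → ℝ) :
    ∏ k, g k = ∏ b, ∏ j, g (finProdFinEquiv (b, j)) := by
  rw [← Equiv.prod_comp finProdFinEquiv, Fintype.prod_prod_type]

lemma exists_code_of_blockCodes {n : ℕ} {pS : 𝒮 → ℝ} {W : 𝒳₁ → 𝒳₂ → 𝒮 → 𝒴₂ × 𝒴₃ → ℝ}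
    (D : RelayModel (Fin n → 𝒮) (Fin n → T) (Fin n → 𝒳₁) (Fin n → 𝒳₂) (Fin n → 𝒴₂ × 𝒴₃)
      (Fin n → 𝒴₂) (Fin n → 𝒴₃) (Fin n → H))
    (hS : ∀ s, D.pS s = ∏ j, pS (s j))
    (hW : ∀ x₁ x₂ s y, D.W x₁ x₂ s y = ∏ j, W (x₁ j) (x₂ j) (s j) (y j))
    (h₂ : ∀ y, D.π₂ y = fun j => (y j).1) (h₃ : ∀ y, D.π₃ y = fun j => (y j).2)
    {Ms Mo : Type} [Fintype Ms] [Fintype Mo] [Nonempty Ms] {ε : ℝ}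
    (hex : ∀ Q : Mo × Ms → ℝ, IsPmf Q → ∃ C : BlockCode (Fin n → 𝒮) (Fin n → 𝒳₁) (Fin n → 𝒳₂)
      (Fin n → 𝒴₂) (Fin n → 𝒴₃) Mo Ms, Ex Q (fun x => D.blockErr C x.1 x.2) ≤ ε)
    (m₀ : Mo) (B : ℕ) :
    ∃ (enc1 : Fin (Fintype.card Ms ^ B) → (Fin ((B + 1) * n) → 𝒮) → Fin ((B + 1) * n) → 𝒳₁)
      (enc2 : (Fin ((B + 1) * n) → 𝒴₂) → Fin ((B + 1) * n) → 𝒳₂)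
      (dec2 : (Fin ((B + 1) * n) → 𝒴₃) → Fin (Fintype.card Ms ^ B)),
      (∀ y y' (j : Fin ((B + 1) * n)), (∀ i, i < j → y i = y' i) → enc2 y j = enc2 y' j) ∧
      errProbRCsrc pS W enc1 enc2 dec2 ≤ (B + 1 : ℕ) * ε := by
  obtain ⟨C, w₀, hC⟩ := D.exists_multiBlock hex m₀ B
  have σ : Fin (Fintype.card Ms ^ B) ≃ (Fin B → Ms) :=
    (Fintype.equivFinOfCardEq (by simp)).symm
  let e : Fin (B + 1) × Fin n ≃ Fin ((B + 1) * n) := finProdFinEquiv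
  refine ⟨fun w s k => (C (e.symm k).1).enc (Fin.snoc (α := fun _ => Ms) (σ w) w₀ (e.symm k).1)
      ((blocksEquiv _ _ _).symm s (e.symm k).1) (e.symm k).2,
    fun y k => (C (e.symm k).1).word
      (relayIdx C (B + 1) m₀ ((blocksEquiv _ _ _).symm y) (e.symm k).1.castSucc) (e.symm k).2,
    fun y => σ.symm (decodeAll C B ((blocksEquiv _ _ _).symm y)), ?_, ?_⟩
  · intro y y' k h
    obtain ⟨⟨b, j⟩, rfl⟩ := e.surjective k
    simp only [Equiv.symm_apply_apply]
    have : relayIdx C (B + 1) m₀ ((blocksEquiv _ _ _).symm y) b.castSucc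
        = relayIdx C (B + 1) m₀ ((blocksEquiv _ _ _).symm y') b.castSucc := by
      refine stateAt_causal _ _ _ _ _ _ fun i hi => funext fun j' => h _ ?_
      rw [Fin.lt_def]
      simp only [e, finProdFinEquiv_apply_val] at hi ⊢
      rw [Fin.val_castSucc, Fin.lt_def.symm] at hi
      have h1 : (i : ℕ) + 1 ≤ b := hi
      have h2 := j'.2
      show (j' : ℕ) + n * i < j + n * b
      nlinarith
    rw [this]
  · refine le_trans (le_of_eq ?_) hC
    unfold errProbRCsrc
    rw [Ex, ← Equiv.sum_comp σ]
    refine sum_congr rfl fun w _ => ?_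
    rw [← Equiv.sum_comp (blocksEquiv (B + 1) n 𝒮), Finset.mul_sum]
    refine sum_congr rfl fun s _ => ?_
    rw [← Equiv.sum_comp (blocksEquiv (B + 1) n (𝒴₂ × 𝒴₃)), Finset.mul_sum]
    refine sum_congr rfl fun y _ => ?_
    simp only [blocksEquiv_comp, Equiv.symm_apply_apply, prod_blocks, blocksEquiv_apply, h₂, h₃,
      hS, hW, e]
    by_cases h : decodeAll C B (fun i j => (y i j).2) = σ w
    · rw [if_pos (by rw [h, Equiv.symm_apply_apply]), ind_false (by simpa using h)]
      simp
    · rw [if_neg (by rwa [Equiv.symm_apply_eq]), ind_true h]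
      simp only [unif, Fintype.card_pi, prod_const, card_univ, Fintype.card_fin]
      ring

end Flatten

end RelayModel

/-! ### Distributions and entropies of random variables -/

section RandomVariables

variable {Ω A A' : Type} [Fintype Ω] [Fintype A] [Fintype A'] {μ : Ω → ℝ}

lemma Ex_rvDist (μ : Ω → ℝ) (X : Ω → A) (F : A → ℝ) :
    Ex (rvDist μ X) F = Ex μ fun ω => F (X ω) := by
  simp only [Ex, rvDist, Finset.sum_mul]
  rw [sum_comm]
  refine sum_congr rfl fun ω _ => ?_
  simp

lemma isPmf_rvDist (hμ : IsPmf μ) (X : Ω → A) : IsPmf (rvDist μ X) := by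
  refine ⟨fun a => sum_nonneg fun ω _ => ?_, ?_⟩
  · split_ifs
    exacts [hμ.1 ω, le_rfl]
  · have h := Ex_rvDist μ X fun _ => 1
    rw [Ex_const hμ] at h
    simpa only [Ex, mul_one] using h

lemma rvDist_pos (hμ : ∀ ω, 0 ≤ μ ω) (X : Ω → A) {ω : Ω} (hω : 0 < μ ω) :
    0 < rvDist μ X (X ω) := by
  have hnn : ∀ ω' ∈ (univ : Finset Ω), 0 ≤ if X ω' = X ω then μ ω' else 0 := fun ω' _ => by
    split_ifs
    exacts [hμ ω', le_rfl]
  have := single_le_sum hnn (mem_univ ω)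
  rw [if_pos rfl] at this
  exact hω.trans_le this

lemma Ex_log_rvDist (μ : Ω → ℝ) (X : Ω → A) :
    Ex μ (fun ω => Real.logb 2 (rvDist μ X (X ω))) = -rvEnt μ X := by
  rw [← Ex_rvDist μ X fun a => Real.logb 2 (rvDist μ X a), rvEnt, neg_neg, Ex]

lemma rvEnt_comp_injective (μ : Ω → ℝ) (X : Ω → A) {e : A → A'} (he : Function.Injective e) :
    rvEnt μ (fun ω => e (X ω)) = rvEnt μ X := by
  rw [← neg_inj, ← Ex_log_rvDist, ← Ex_log_rvDist]
  simp only [rvDist, he.eq_iff]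

lemma Ex_congr_of_pos {p f g : A → ℝ} (hp : ∀ a, 0 ≤ p a) (h : ∀ a, 0 < p a → f a = g a) :
    Ex p f = Ex p g := by
  refine sum_congr rfl fun a _ => ?_
  rcases (hp a).eq_or_lt with h0 | h0
  · rw [← h0, zero_mul, zero_mul]
  · rw [h a h0]

/-- Gibbs' inequality. -/
lemma Ex_log_sub_nonneg {p a b : A → ℝ} (hp : IsPmf p)
    (hab : ∀ x, 0 < p x → 0 < a x ∧ 0 < b x) (h : Ex p (fun x => b x / a x) ≤ 1) :
    0 ≤ Ex p (fun x => Real.logb 2 (a x)) - Ex p (fun x => Real.logb 2 (b x)) := by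
  have hlog : 0 < Real.log 2 := Real.log_pos (by norm_num)
  have hle : Ex p (fun x => Real.logb 2 (b x))
      ≤ Ex p (fun x => Real.logb 2 (a x) + (Real.log 2)⁻¹ * (b x / a x + -1)) := by
    refine sum_le_sum fun x _ => ?_
    rcases (hp.1 x).eq_or_lt with h0 | h0
    · rw [← h0, zero_mul, zero_mul]
    · obtain ⟨ha, hb⟩ := hab x h0
      refine mul_le_mul_of_nonneg_left ?_ h0.le
      have h1 := Real.log_le_sub_one_of_pos (div_pos hb ha)
      rw [Real.log_div hb.ne' ha.ne'] at h1
      simp only [Real.logb, div_eq_inv_mul (Real.log _) (Real.log 2), ← mul_add]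
      gcongr
      linarith
  rw [Ex_add, Ex_mul_left, Ex_add, Ex_const hp] at hle
  have : (Real.log 2)⁻¹ * (Ex p (fun x => b x / a x) + -1) ≤ 0 :=
    mul_nonpos_of_nonneg_of_nonpos (by positivity) (by linarith)
  linarith

end RandomVariables

/-! ### Product measures -/

section Product

variable {ι A B Ω : Type} [Fintype ι] [DecidableEq ι] [Fintype A] [Fintype B] [Fintype Ω]

lemma Ex_piPmf_compPmf (p : ι → A → ℝ) (κ : ι → A → B → ℝ) (F : (ι → A × B) → ℝ) :
    Ex (piPmf fun i => compPmf (p i) (κ i)) F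
      = Ex (piPmf p) fun a => Ex (piPmf fun i => κ i (a i)) fun b => F fun i => (a i, b i) := by
  simp only [Ex]
  rw [← Equiv.sum_comp (Equiv.arrowProdEquivProdArrow ι (fun _ => A) (fun _ => B)).symm,
    Fintype.sum_prod_type]
  refine sum_congr rfl fun a _ => ?_
  rw [Finset.mul_sum]
  refine sum_congr rfl fun b _ => ?_
  simp only [Equiv.arrowProdEquivProdArrow, Equiv.coe_fn_symm_mk, piPmf, compPmf,
    prod_mul_distrib, mul_assoc]

lemma Ex_piPmf_rvDist (μ : Ω → ℝ) (X : Ω → A) (F : (ι → A) → ℝ) :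
    Ex (piPmf fun _ : ι => rvDist μ X) F
      = Ex (piPmf fun _ : ι => μ) fun ω => F fun i => X (ω i) := by
  have h : ∀ v : ι → A, piPmf (fun _ : ι => rvDist μ X) v
      = ∑ ω : ι → Ω, if (fun i => X (ω i)) = v then piPmf (fun _ : ι => μ) ω else 0 := by
    intro v
    simp only [piPmf, rvDist]
    rw [prod_univ_sum, Fintype.piFinset_univ]
    refine sum_congr rfl fun ω _ => ?_
    simp only [funext_iff]
    rw [prod_ite_zero]
    simp
  simp only [Ex, h, Finset.sum_mul]
  rw [sum_comm]
  refine sum_congr rfl fun ω _ => ?_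
  simp

lemma Ex_piPmf_equiv (e : A ≃ B) (p : A → ℝ) (F : (ι → A) → ℝ) :
    Ex (piPmf fun _ : ι => p) F
      = Ex (piPmf fun _ : ι => fun b => p (e.symm b)) fun f => F fun i => e.symm (f i) := by
  simp only [Ex]
  rw [← Equiv.sum_comp (Equiv.arrowCongr (Equiv.refl ι) e).symm]
  rfl

/-- Sequences on which a likelihood ratio is at least `Γ` have probability at most `1 / Γ`. -/
lemma packing {p q : A → ℝ} (hq : IsPmf q) {Γ : ℝ} (hΓ : 0 < Γ) :
    Ex (piPmf fun _ : ι => p) (fun f => ind (Γ * ∏ i, p (f i) ≤ ∏ i, q (f i))) ≤ 1 / Γ := by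
  have h : ∀ f : ι → A, piPmf (fun _ : ι => p) f * ind (Γ * ∏ i, p (f i) ≤ ∏ i, q (f i))
      ≤ 1 / Γ * piPmf (fun _ : ι => q) f := by
    intro f
    have h0 : 0 ≤ piPmf (fun _ : ι => q) f := (isPmf_piPmf fun _ => hq).1 f
    by_cases hf : Γ * ∏ i, p (f i) ≤ ∏ i, q (f i)
    · rw [ind_true hf, mul_one, one_div, ← div_eq_inv_mul, le_div_iff₀' hΓ]
      exact hf
    · rw [ind_false hf, mul_zero]
      positivity
  refine (sum_le_sum fun f _ => h f).trans_eq ?_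
  rw [← Finset.mul_sum, (isPmf_piPmf fun _ => hq).2, mul_one]

lemma packing' {p q : A → ℝ} (hq : IsPmf q) {Γ : ℝ} (hΓ : 0 < Γ) (hp : ∀ a, 0 ≤ p a)
    {P : (ι → A) → Prop} (hP : ∀ f, P f → Γ * ∏ i, p (f i) ≤ ∏ i, q (f i)) :
    Ex (piPmf fun _ : ι => p) (fun f => ind (P f)) ≤ 1 / Γ := by
  refine le_trans (Ex_mono (fun f => prod_nonneg fun i _ => hp _) fun f => ?_)
    (packing (p := p) hq hΓ)
  exact ind_le_of_imp (ind_nonneg _) fun h => (ind_true (hP f h)).ge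

lemma packing_kernel {μ : Ω → ℝ} (hμ : IsPmf μ) (X : Ω → A) {κ : A → B → ℝ}
    (hκ : ∀ a, IsPmf (κ a)) {q : A × B → ℝ} (hq : IsPmf q) {Γ : ℝ} (hΓ : 0 < Γ)
    {P : (ι → A) → (ι → B) → Prop}
    (hP : ∀ a b, P a b →
      Γ * ∏ i, (rvDist μ X (a i) * κ (a i) (b i)) ≤ ∏ i, q (a i, b i)) :
    (Ex (piPmf fun _ : ι => μ) fun ω => Ex (piPmf fun i => κ (X (ω i))) fun b =>
      ind (P (fun i => X (ω i)) b)) ≤ 1 / Γ := by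
  rw [← Ex_piPmf_rvDist μ X fun a => Ex (piPmf fun i => κ (a i)) fun b => ind (P a b),
    ← Ex_piPmf_compPmf (fun _ => rvDist μ X) (fun _ => κ)
      fun f => ind (P (fun i => (f i).1) fun i => (f i).2)]
  exact packing' hq hΓ (isPmf_compPmf (isPmf_rvDist hμ X) hκ).1 fun f hf => hP _ _ hf

/-- Weak law of large numbers for log-likelihood ratios. -/
lemma exists_lln_upper {p : A → ℝ} (hp : IsPmf p) {a b : A → ℝ}
    (hab : ∀ x, 0 < p x → 0 < a x ∧ 0 < b x) {δ : ℝ} (hδ : 0 < δ) {I : ℝ}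
    (hI : Ex p (fun x => Real.logb 2 (a x)) - Ex p (fun x => Real.logb 2 (b x)) = I) :
    ∃ c : ℝ, ∀ n : ℕ, 0 < n → Ex (piPmf fun _ : Fin n => p)
      (fun f => ind ((2 : ℝ) ^ ((n : ℝ) * (I + δ)) * ∏ i, b (f i) < ∏ i, a (f i))) ≤ c / n := by
  set g : A → ℝ := fun x => (Real.logb 2 (a x) + -1 * Real.logb 2 (b x)) + -I with hg
  have hg0 : Ex p g = 0 := by
    rw [hg, Ex_add, Ex_add, Ex_mul_left, Ex_const hp, ← hI]
    ring
  refine ⟨Ex p (fun x => g x ^ 2) / δ ^ 2, fun n hn => ?_⟩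
  have hn' : (0 : ℝ) < n := by exact_mod_cast hn
  have hch := Ex_pi_chebyshev (ι := Fin n) hp hg0 (c := n * δ) (by positivity)
    (fun f => (∀ i, 0 < p (f i)) ∧
      (2 : ℝ) ^ ((n : ℝ) * (I + δ)) * ∏ i, b (f i) < ∏ i, a (f i)) (by
      rintro f ⟨hpos, hf⟩
      have hb : 0 < ∏ i, b (f i) := prod_pos fun i _ => (hab _ (hpos i)).2
      have h1 := Real.logb_lt_logb (b := 2) (by norm_num) (by positivity) hf
      rw [Real.logb_mul (by positivity) hb.ne', Real.logb_rpow (by norm_num) (by norm_num),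
        Real.logb_prod _ _ fun i _ => (hab _ (hpos i)).2.ne',
        Real.logb_prod _ _ fun i _ => (hab _ (hpos i)).1.ne'] at h1
      have h2 : ∑ i, g (f i) = ∑ i, Real.logb 2 (a (f i)) - ∑ i, Real.logb 2 (b (f i)) - n * I := by
        simp only [hg, sum_add_distrib, ← Finset.mul_sum]
        simp
        ring
      have h3 : (n : ℝ) * δ ≤ ∑ i, g (f i) := by rw [h2]; linarith
      exact pow_le_pow_left₀ (by positivity) h3 2)
  rw [Ex_congr_of_pos (g := fun f => ind ((∀ i, 0 < p (f i)) ∧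
      (2 : ℝ) ^ ((n : ℝ) * (I + δ)) * ∏ i, b (f i) < ∏ i, a (f i)))
    (isPmf_piPmf fun _ => hp).1 fun f hf => ?_]
  · refine hch.trans_eq ?_
    rw [Fintype.card_fin]
    field_simp
  · have : ∀ i, 0 < p (f i) := fun i =>
      (hp.1 _).lt_of_ne' (prod_ne_zero_iff.1 hf.ne' i (mem_univ i))
    simp only [this, implies_true, true_and]

lemma exists_lln_lower {p : A → ℝ} (hp : IsPmf p) {a b : A → ℝ}
    (hab : ∀ x, 0 < p x → 0 < a x ∧ 0 < b x) {δ : ℝ} (hδ : 0 < δ) {I : ℝ}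
    (hI : Ex p (fun x => Real.logb 2 (a x)) - Ex p (fun x => Real.logb 2 (b x)) = I) :
    ∃ c : ℝ, ∀ n : ℕ, 0 < n → Ex (piPmf fun _ : Fin n => p)
      (fun f => ind (¬(2 : ℝ) ^ ((n : ℝ) * (I - δ)) * ∏ i, b (f i) ≤ ∏ i, a (f i))) ≤ c / n := by
  obtain ⟨c, hc⟩ := exists_lln_upper hp (fun x hx => (hab x hx).symm) hδ (I := -I)
    (by rw [← hI]; ring)
  refine ⟨c, fun n hn => (Ex_mono (isPmf_piPmf fun _ => hp).1 fun f => ?_).trans (hc n hn)⟩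
  refine ind_le_of_imp (ind_nonneg _) fun h => (ind_true ?_).ge
  rw [not_le] at h
  have hpos : (0 : ℝ) < 2 ^ ((n : ℝ) * (-I + δ)) := by positivity
  calc _ < (2 : ℝ) ^ ((n : ℝ) * (-I + δ)) * ((2 : ℝ) ^ ((n : ℝ) * (I - δ)) * ∏ i, b (f i)) := by
        gcongr
    _ = _ := by
        rw [← mul_assoc, ← Real.rpow_add (by norm_num)]
        ring_nf
        simp

end Product

/-! ### Memoryless models -/

lemma rvDist_eq_of_Ex {Ω A : Type} [Fintype Ω] [Fintype A] {μ : Ω → ℝ} {X : Ω → A} {p : A → ℝ}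
    (h : ∀ F, Ex μ (fun ω => F (X ω)) = Ex p F) : rvDist μ X = p := by
  funext a
  have h1 := h fun b => if b = a then 1 else 0
  rw [← Ex_rvDist μ X fun b => if b = a then 1 else 0] at h1
  simpa [Ex] using h1

namespace RelayModel

section Power

variable {S T X₁ X₂ Y Y₂ Y₃ H : Type} [Fintype S] [Fintype T] [Fintype X₁]
  [Fintype X₂] [Fintype Y] [Fintype H]

/-- `n` independent uses of a relay model. -/
def pow (D : RelayModel S T X₁ X₂ Y Y₂ Y₃ H) (n : ℕ) :
    RelayModel (Fin n → S) (Fin n → T) (Fin n → X₁) (Fin n → X₂) (Fin n → Y) (Fin n → Y₂)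
      (Fin n → Y₃) (Fin n → H) where
  pS := piPmf fun _ => D.pS
  pT s := piPmf fun i => D.pT (s i)
  pX1 t s := piPmf fun i => D.pX1 (t i) (s i)
  pX2 := piPmf fun _ => D.pX2
  W x₁ x₂ s := piPmf fun i => D.W (x₁ i) (x₂ i) (s i)
  pH y x := piPmf fun i => D.pH (y i) (x i)
  qT := piPmf fun _ => D.qT
  qH x := piPmf fun i => D.qH (x i)
  π₂ y i := D.π₂ (y i)
  π₃ y i := D.π₃ (y i)
  hpS := isPmf_piPmf fun _ => D.hpS
  hpT _ := isPmf_piPmf fun _ => D.hpT _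
  hpX1 _ _ := isPmf_piPmf fun _ => D.hpX1 _ _
  hpX2 := isPmf_piPmf fun _ => D.hpX2
  hW _ _ _ := isPmf_piPmf fun _ => D.hW _ _ _
  hpH _ _ := isPmf_piPmf fun _ => D.hpH _ _
  hqT := isPmf_piPmf fun _ => D.hqT
  hqH _ := isPmf_piPmf fun _ => D.hqH _

end Power

variable {S T X₁ X₂ Y₂ Y₃ H : Type} [Fintype S] [Fintype T] [Fintype X₁]
  [Fintype X₂] [Fintype Y₂] [Fintype Y₃] [Fintype H]
  (D : RelayModel S T X₁ X₂ (Y₂ × Y₃) Y₂ Y₃ H)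

/-- Joint test distribution. -/
def law (ω : ΩRCsrc S T X₁ X₂ Y₂ Y₃ H) : ℝ :=
  D.pS (vS ω) * D.pX2 (vX2 ω) * D.pT (vS ω) (vT1 ω) * D.pX1 (vT1 ω) (vS ω) (vX1 ω) *
    D.W (vX1 ω) (vX2 ω) (vS ω) (vY2 ω, vY3 ω) * D.pH (vY2 ω) (vX2 ω) (vYH ω)

/-- The variables of the joint law in the order in which they are generated. -/
def lawEquiv : ΩRCsrc S T X₁ X₂ Y₂ Y₃ H ≃ X₂ × S × T × X₁ × (Y₂ × Y₃) × H where
  toFun ω := (vX2 ω, vS ω, vT1 ω, vX1 ω, (vY2 ω, vY3 ω), vYH ω)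
  invFun z := (z.2.1, z.2.2.1, z.2.2.2.1, z.1, z.2.2.2.2.1.1, z.2.2.2.2.1.2, z.2.2.2.2.2)
  left_inv _ := rfl
  right_inv _ := rfl

lemma law_lawEquiv_symm : (fun z => D.law (lawEquiv.symm z)) =
    compPmf D.pX2 fun x => compPmf D.pS fun s => compPmf (D.pT s) fun t =>
      compPmf (D.pX1 t s) fun x₁ => compPmf (D.W x₁ x s) fun y => D.pH y.1 x := by
  funext ⟨x, s, t, x₁, ⟨y₂, y₃⟩, a⟩
  simp only [law, lawEquiv, compPmf, vS, vT1, vX1, vX2, vY2, vY3, vYH, Equiv.coe_fn_symm_mk]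
  ring

variable {D}

lemma pow_ideal (h₂ : D.π₂ = Prod.fst) (n : ℕ)
    (F : (Fin n → S) → (Fin n → T) → (Fin n → X₁) → (Fin n → X₂) → (Fin n → Y₂ × Y₃) →
      (Fin n → H) → ℝ) :
    (D.pow n).ideal F = Ex (piPmf fun _ : Fin n => D.law) fun ω =>
      F (fun i => vS (ω i)) (fun i => vT1 (ω i)) (fun i => vX1 (ω i)) (fun i => vX2 (ω i))
        (fun i => (vY2 (ω i), vY3 (ω i))) (fun i => vYH (ω i)) := by
  rw [Ex_piPmf_equiv lawEquiv, law_lawEquiv_symm]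
  simp only [Ex_piPmf_compPmf]
  simp only [ideal, pow, h₂]
  rfl

lemma Ex_law (F : S → T → X₁ → X₂ → Y₂ → Y₃ → H → ℝ) :
    (Ex D.law fun ω => F (vS ω) (vT1 ω) (vX1 ω) (vX2 ω) (vY2 ω) (vY3 ω) (vYH ω)) =
      Ex D.pX2 fun x => Ex D.pS fun s => Ex (D.pT s) fun t => Ex (D.pX1 t s) fun x₁ =>
        Ex (D.W x₁ x s) fun y => Ex (D.pH y.1 x) fun a => F s t x₁ x y.1 y.2 a := by
  trans Ex (fun z => D.law (lawEquiv.symm z))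
    fun z => F z.2.1 z.2.2.1 z.2.2.2.1 z.1 z.2.2.2.2.1.1 z.2.2.2.2.1.2 z.2.2.2.2.2
  swap
  · rw [law_lawEquiv_symm]
    simp only [Ex_compPmf]
  simp only [Ex]
  rw [← Equiv.sum_comp lawEquiv.symm]
  rfl

lemma isPmf_law : IsPmf D.law := by
  refine ⟨fun ω => ?_, ?_⟩
  · have h1 := D.hpS.1 (vS ω)
    have h2 := D.hpX2.1 (vX2 ω)
    have h3 := (D.hpT (vS ω)).1 (vT1 ω)
    have h4 := (D.hpX1 (vT1 ω) (vS ω)).1 (vX1 ω)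
    have h5 := (D.hW (vX1 ω) (vX2 ω) (vS ω)).1 (vY2 ω, vY3 ω)
    have h6 := (D.hpH (vY2 ω) (vX2 ω)).1 (vYH ω)
    unfold law
    positivity
  · have h := D.Ex_law fun _ _ _ _ _ _ _ => 1
    simp only [Ex_const D.hpS, Ex_const D.hpX2, Ex_const (D.hpT _), Ex_const (D.hpX1 _ _),
      Ex_const (D.hW _ _ _), Ex_const (D.hpH _ _)] at h
    simpa only [Ex, mul_one] using h

lemma rvDist_T_S : rvDist D.law (fun ω => (vT1 ω, vS ω)) = fun z => D.pS z.2 * D.pT z.2 z.1 := by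
  refine rvDist_eq_of_Ex fun F => ?_
  rw [Ex_law fun s t _ _ _ _ _ => F (t, s)]
  simp only [Ex_const D.hpX2, Ex_const (D.hpX1 _ _), Ex_const (D.hW _ _ _), Ex_const (D.hpH _ _)]
  simp only [Ex, Fintype.sum_prod_type_right, Finset.mul_sum, mul_assoc]

lemma rvDist_S : rvDist D.law vS = D.pS := by
  refine rvDist_eq_of_Ex fun F => ?_
  rw [Ex_law fun s _ _ _ _ _ _ => F s]
  simp only [Ex_const D.hpX2, Ex_const (D.hpT _), Ex_const (D.hpX1 _ _), Ex_const (D.hW _ _ _),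
    Ex_const (D.hpH _ _)]

lemma rvDist_X2 : rvDist D.law vX2 = D.pX2 := by
  refine rvDist_eq_of_Ex fun F => ?_
  rw [Ex_law fun _ _ _ x _ _ _ => F x]
  simp only [Ex_const D.hpS, Ex_const (D.hpT _), Ex_const (D.hpX1 _ _), Ex_const (D.hW _ _ _),
    Ex_const (D.hpH _ _)]

lemma rvDist_T_X2 : rvDist D.law (fun ω => (vT1 ω, vX2 ω))
    = fun z => rvDist D.law vT1 z.1 * D.pX2 z.2 := by
  refine rvDist_eq_of_Ex fun F => ?_
  have h : Ex (fun z => rvDist D.law vT1 z.1 * D.pX2 z.2) F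
      = Ex D.pX2 fun x => Ex (rvDist D.law vT1) fun t => F (t, x) := by
    simp only [Ex, Fintype.sum_prod_type_right, Finset.mul_sum]
    exact sum_congr rfl fun _ _ => sum_congr rfl fun _ _ => by ring
  rw [h, Ex_law fun _ t _ x _ _ _ => F (t, x)]
  refine Ex_congr fun x => ?_
  rw [Ex_rvDist, Ex_law fun _ t _ _ _ _ _ => F (t, x)]
  simp only [Ex_const D.hpX2, Ex_const (D.hpX1 _ _), Ex_const (D.hW _ _ _), Ex_const (D.hpH _ _)]

lemma rvDist_H_Y2_X2_Y3 : rvDist D.law (fun ω => (vYH ω, vY2 ω, (vX2 ω, vY3 ω)))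
    = fun z => rvDist D.law (fun ω => (vY2 ω, (vX2 ω, vY3 ω))) z.2 * D.pH z.2.1 z.2.2.1 z.1 := by
  refine rvDist_eq_of_Ex fun F => ?_
  have h : Ex (fun z => rvDist D.law (fun ω => (vY2 ω, (vX2 ω, vY3 ω))) z.2
      * D.pH z.2.1 z.2.2.1 z.1) F
      = Ex (rvDist D.law (fun ω => (vY2 ω, (vX2 ω, vY3 ω)))) fun z =>
        Ex (D.pH z.1 z.2.1) fun a => F (a, z) := by
    simp only [Ex, Fintype.sum_prod_type_right (α₁ := H), Finset.mul_sum, mul_assoc]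
  rw [h, Ex_rvDist, Ex_law fun _ _ _ x y₂ y₃ a => F (a, y₂, (x, y₃)),
    Ex_law fun _ _ _ x y₂ y₃ _ => Ex (D.pH y₂ x) fun a => F (a, y₂, (x, y₃))]
  simp only [Ex_const (D.hpH _ _)]

end RelayModel

/-! ### Information identities for the test distribution -/

lemma Ex_logb_mul {A : Type} [Fintype A] {p a b : A → ℝ} (hp : ∀ x, 0 ≤ p x)
    (hab : ∀ x, 0 < p x → 0 < a x ∧ 0 < b x) :
    Ex p (fun x => Real.logb 2 (a x * b x))
      = Ex p (fun x => Real.logb 2 (a x)) + Ex p (fun x => Real.logb 2 (b x)) := by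
  rw [← Ex_add]
  exact Ex_congr_of_pos hp fun x hx => Real.logb_mul (hab x hx).1.ne' (hab x hx).2.ne'

namespace RelayModel

variable {S T X₁ X₂ Y₂ Y₃ H : Type} [Fintype S] [Fintype T] [Fintype X₁]
  [Fintype X₂] [Fintype Y₂] [Fintype Y₃] [Fintype H]
  {D : RelayModel S T X₁ X₂ (Y₂ × Y₃) Y₂ Y₃ H}

lemma pos_of_law_pos {ω : ΩRCsrc S T X₁ X₂ Y₂ Y₃ H} (hω : 0 < D.law ω) :
    0 < D.pS (vS ω) ∧ 0 < D.pX2 (vX2 ω) ∧ 0 < D.pT (vS ω) (vT1 ω) ∧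
      0 < D.pH (vY2 ω) (vX2 ω) (vYH ω) := by
  have h := hω.ne'
  simp only [law, ne_eq, mul_eq_zero, not_or] at h
  obtain ⟨⟨⟨⟨⟨h1, h2⟩, h3⟩, -⟩, -⟩, h6⟩ := h
  exact ⟨(D.hpS.1 _).lt_of_ne' h1, (D.hpX2.1 _).lt_of_ne' h2, ((D.hpT _).1 _).lt_of_ne' h3,
    ((D.hpH _ _).1 _).lt_of_ne' h6⟩

variable (D) in
/-- The reference distributions are the marginals of the test distribution. -/
def IsMarginal : Prop :=
  D.qT = rvDist D.law vT1 ∧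
    ∀ x a, rvDist D.law (fun ω => (vX2 ω, vYH ω)) (x, a) = D.pX2 x * D.qH x a

namespace IsMarginal

lemma qT_pos (hD : D.IsMarginal) {ω : ΩRCsrc S T X₁ X₂ Y₂ Y₃ H} (hω : 0 < D.law ω) :
    0 < D.qT (vT1 ω) := by
  rw [hD.1]
  exact rvDist_pos isPmf_law.1 vT1 hω

lemma qH_pos (hD : D.IsMarginal) {ω : ΩRCsrc S T X₁ X₂ Y₂ Y₃ H} (hω : 0 < D.law ω) :
    0 < D.qH (vX2 ω) (vYH ω) := by
  have h := rvDist_pos isPmf_law.1 (fun ω => (vX2 ω, vYH ω)) hω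
  rw [hD.2] at h
  exact (pos_iff_pos_of_mul_pos h).1 (pos_of_law_pos hω).2.1

lemma Ex_log_qT (hD : D.IsMarginal) :
    Ex D.law (fun ω => Real.logb 2 (D.qT (vT1 ω))) = -rvEnt D.law vT1 := by
  rw [hD.1, Ex_log_rvDist]

lemma rvMI_T_S (hD : D.IsMarginal) :
    Ex D.law (fun ω => Real.logb 2 (D.pT (vS ω) (vT1 ω)))
      - Ex D.law (fun ω => Real.logb 2 (D.qT (vT1 ω))) = rvMI D.law vT1 vS := by
  have h1 := Ex_log_rvDist D.law fun ω => (vT1 ω, vS ω)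
  have h2 := Ex_log_rvDist D.law vS
  rw [rvDist_T_S, Ex_logb_mul isPmf_law.1 fun ω hω =>
    ⟨(pos_of_law_pos hω).1, (pos_of_law_pos hω).2.2.1⟩] at h1
  rw [rvDist_S] at h2
  rw [hD.Ex_log_qT, rvMI]
  linarith

lemma rvMI_X2_Y3 :
    Ex D.law (fun ω => Real.logb 2 (rvDist D.law (fun ω => (vY3 ω, vX2 ω)) (vY3 ω, vX2 ω)))
      - Ex D.law (fun ω => Real.logb 2 (rvDist D.law vY3 (vY3 ω) * D.pX2 (vX2 ω)))
      = rvMI D.law vX2 vY3 := by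
  rw [Ex_logb_mul isPmf_law.1 fun ω hω =>
      ⟨rvDist_pos isPmf_law.1 vY3 hω, (pos_of_law_pos hω).2.1⟩,
    Ex_log_rvDist D.law fun ω => (vY3 ω, vX2 ω), Ex_log_rvDist D.law vY3, ← rvDist_X2,
    Ex_log_rvDist, rvMI,
    ← rvEnt_comp_injective D.law (fun ω => (vY3 ω, vX2 ω)) Prod.swap_injective]
  simp only [Prod.swap_prod_mk]
  ring

lemma rvCMI_T_H_Y3 (hD : D.IsMarginal) :
    Ex D.law (fun ω => Real.logb 2 (rvDist D.law (fun ω => (((vY3 ω, vX2 ω), vYH ω), vT1 ω))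
        (((vY3 ω, vX2 ω), vYH ω), vT1 ω)))
      - Ex D.law (fun ω => Real.logb 2 (rvDist D.law (fun ω => ((vY3 ω, vX2 ω), vYH ω))
        ((vY3 ω, vX2 ω), vYH ω) * D.qT (vT1 ω)))
      = rvCMI D.law vT1 (fun ω => (vYH ω, vY3 ω)) vX2 := by
  have h1 := Ex_log_rvDist D.law fun ω => (vT1 ω, vX2 ω)
  rw [rvDist_T_X2, Ex_logb_mul isPmf_law.1 fun ω hω =>
    ⟨rvDist_pos isPmf_law.1 vT1 hω, (pos_of_law_pos hω).2.1⟩, Ex_log_rvDist, ← rvDist_X2,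
    Ex_log_rvDist] at h1
  rw [Ex_logb_mul isPmf_law.1 fun ω hω =>
      ⟨rvDist_pos isPmf_law.1 (fun ω => ((vY3 ω, vX2 ω), vYH ω)) hω, hD.qT_pos hω⟩,
    Ex_log_rvDist D.law fun ω => (((vY3 ω, vX2 ω), vYH ω), vT1 ω),
    Ex_log_rvDist D.law fun ω => ((vY3 ω, vX2 ω), vYH ω), hD.Ex_log_qT, rvCMI,
    ← rvEnt_comp_injective D.law (fun ω => (((vY3 ω, vX2 ω), vYH ω), vT1 ω))
      (e := fun z => (z.2, (z.1.2, z.1.1.1), z.1.1.2))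
      (by rintro ⟨⟨⟨_, _⟩, _⟩, _⟩ ⟨⟨⟨_, _⟩, _⟩, _⟩ h; simp_all),
    ← rvEnt_comp_injective D.law (fun ω => ((vY3 ω, vX2 ω), vYH ω))
      (e := fun z => ((z.2, z.1.1), z.1.2))
      (by rintro ⟨⟨_, _⟩, _⟩ ⟨⟨_, _⟩, _⟩ h; simp_all)]
  linarith

lemma quantization_rate_le (hD : D.IsMarginal) :
    (Ex D.law (fun ω => Real.logb 2 (D.pH (vY2 ω) (vX2 ω) (vYH ω)))
      - Ex D.law (fun ω => Real.logb 2 (D.qH (vX2 ω) (vYH ω))))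
    + rvCMI D.law vT1 (fun ω => (vYH ω, vY3 ω)) vX2
    - (Ex D.law (fun ω => Real.logb 2 (rvDist D.law
        (fun ω => ((vY3 ω, vX2 ω), (vYH ω, vT1 ω))) ((vY3 ω, vX2 ω), (vYH ω, vT1 ω))))
      - Ex D.law (fun ω => Real.logb 2 (rvDist D.law (fun ω => (vY3 ω, vX2 ω)) (vY3 ω, vX2 ω)
        * (D.qH (vX2 ω) (vYH ω) * D.qT (vT1 ω)))))
    = rvCMI D.law vYH vY2 (fun ω => (vX2 ω, vY3 ω)) := by
  have h1 := Ex_log_rvDist D.law fun ω => (vYH ω, vY2 ω, (vX2 ω, vY3 ω))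
  rw [rvDist_H_Y2_X2_Y3, Ex_logb_mul isPmf_law.1 fun ω hω =>
    ⟨rvDist_pos isPmf_law.1 (fun ω => (vY2 ω, (vX2 ω, vY3 ω))) hω, (pos_of_law_pos hω).2.2.2⟩,
    Ex_log_rvDist D.law fun ω => (vY2 ω, (vX2 ω, vY3 ω))] at h1
  have h2 := hD.rvCMI_T_H_Y3
  rw [Ex_logb_mul isPmf_law.1 fun ω hω =>
      ⟨rvDist_pos isPmf_law.1 (fun ω => ((vY3 ω, vX2 ω), vYH ω)) hω, hD.qT_pos hω⟩,
    Ex_log_rvDist D.law fun ω => (((vY3 ω, vX2 ω), vYH ω), vT1 ω),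
    Ex_log_rvDist D.law fun ω => ((vY3 ω, vX2 ω), vYH ω), hD.Ex_log_qT] at h2
  rw [← h2, Ex_log_rvDist D.law fun ω => ((vY3 ω, vX2 ω), (vYH ω, vT1 ω)),
    Ex_logb_mul isPmf_law.1 fun ω hω =>
      ⟨rvDist_pos isPmf_law.1 (fun ω => (vY3 ω, vX2 ω)) hω,
        mul_pos (hD.qH_pos hω) (hD.qT_pos hω)⟩,
    Ex_logb_mul isPmf_law.1 fun ω hω => ⟨hD.qH_pos hω, hD.qT_pos hω⟩, hD.Ex_log_qT,
    Ex_log_rvDist D.law fun ω => (vY3 ω, vX2 ω), rvCMI,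
    ← rvEnt_comp_injective D.law (fun ω => ((vY3 ω, vX2 ω), (vYH ω, vT1 ω)))
      (e := fun z => ((z.1, z.2.1), z.2.2))
      (by rintro ⟨⟨_, _⟩, _, _⟩ ⟨⟨_, _⟩, _, _⟩ h; simp_all),
    ← rvEnt_comp_injective D.law (fun ω => ((vY3 ω, vX2 ω), vYH ω))
      (e := fun z => (z.2, (z.1.2, z.1.1)))
      (by rintro ⟨⟨_, _⟩, _⟩ ⟨⟨_, _⟩, _⟩ h; simp_all),
    ← rvEnt_comp_injective D.law (fun ω => (vY3 ω, vX2 ω)) Prod.swap_injective]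
  simp only [Prod.swap_prod_mk]
  linarith

lemma rvMI_T_S_nonneg (hD : D.IsMarginal) : 0 ≤ rvMI D.law vT1 vS := by
  rw [← hD.rvMI_T_S]
  refine Ex_log_sub_nonneg isPmf_law (fun ω hω => ⟨(pos_of_law_pos hω).2.2.1, hD.qT_pos hω⟩) ?_
  rw [Ex_law fun s t _ _ _ _ _ => D.qT t / D.pT s t]
  simp only [Ex_const (D.hpX1 _ _), Ex_const (D.hW _ _ _), Ex_const (D.hpH _ _)]
  refine Ex_le_of_le D.hpX2 fun _ => Ex_le_of_le D.hpS fun s => ?_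
  rw [← D.hqT.2]
  refine sum_le_sum fun t _ => ?_
  rcases eq_or_ne (D.pT s t) 0 with h | h
  · rw [h, zero_mul]
    exact D.hqT.1 t
  · rw [mul_div_cancel₀ _ h]

end IsMarginal

end RelayModel

/-! ### Block codes for memoryless models -/

namespace RelayModel

variable {S T X₁ X₂ Y₂ Y₃ H : Type} [Fintype S] [Fintype T] [Fintype X₁]
  [Fintype X₂] [Fintype Y₂] [Fintype Y₃] [Fintype H]
  {D : RelayModel S T X₁ X₂ (Y₂ × Y₃) Y₂ Y₃ H}

/-- Likelihood-ratio test of the destination for the relay codeword. -/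
def binTest (D : RelayModel S T X₁ X₂ (Y₂ × Y₃) Y₂ Y₃ H) {n : ℕ} (Γ : ℝ) (x : Fin n → X₂)
    (y : Fin n → Y₃) : Prop :=
  Γ * ∏ i, (rvDist D.law vY3 (y i) * D.pX2 (x i))
    ≤ ∏ i, rvDist D.law (fun ω => (vY3 ω, vX2 ω)) (y i, x i)

/-- Likelihood-ratio test of the destination for the source codeword. -/
def msgTest (D : RelayModel S T X₁ X₂ (Y₂ × Y₃) Y₂ Y₃ H) {n : ℕ} (Γ Γ' : ℝ) (x : Fin n → X₂)
    (t : Fin n → T) (a : Fin n → H) (y : Fin n → Y₃) : Prop :=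
  Γ * ∏ i, (rvDist D.law (fun ω => ((vY3 ω, vX2 ω), vYH ω)) ((y i, x i), a i) * D.qT (t i))
      ≤ ∏ i, rvDist D.law (fun ω => (((vY3 ω, vX2 ω), vYH ω), vT1 ω)) (((y i, x i), a i), t i) ∧
    Γ' * ∏ i, (rvDist D.law (fun ω => (vY3 ω, vX2 ω)) (y i, x i)
        * (D.qH (x i) (a i) * D.qT (t i)))
      ≤ ∏ i, rvDist D.law (fun ω => ((vY3 ω, vX2 ω), (vYH ω, vT1 ω))) ((y i, x i), (a i, t i))

lemma exists_blockCode_pow (hD : D.IsMarginal) (h₂ : D.π₂ = Prod.fst) (h₃ : D.π₃ = Prod.snd)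
    {I₁ I₂ I₃ I₄ I₅ δ : ℝ} (hδ : 0 < δ)
    (hI₁ : Ex D.law (fun ω => Real.logb 2 (D.pT (vS ω) (vT1 ω)))
      - Ex D.law (fun ω => Real.logb 2 (D.qT (vT1 ω))) = I₁)
    (hI₂ : Ex D.law (fun ω => Real.logb 2 (D.pH (vY2 ω) (vX2 ω) (vYH ω)))
      - Ex D.law (fun ω => Real.logb 2 (D.qH (vX2 ω) (vYH ω))) = I₂)
    (hI₃ : Ex D.law (fun ω => Real.logb 2 (rvDist D.law (fun ω => (vY3 ω, vX2 ω)) (vY3 ω, vX2 ω)))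
      - Ex D.law (fun ω => Real.logb 2 (rvDist D.law vY3 (vY3 ω) * D.pX2 (vX2 ω))) = I₃)
    (hI₄ : Ex D.law (fun ω => Real.logb 2 (rvDist D.law
          (fun ω => (((vY3 ω, vX2 ω), vYH ω), vT1 ω)) (((vY3 ω, vX2 ω), vYH ω), vT1 ω)))
      - Ex D.law (fun ω => Real.logb 2 (rvDist D.law (fun ω => ((vY3 ω, vX2 ω), vYH ω))
        ((vY3 ω, vX2 ω), vYH ω) * D.qT (vT1 ω))) = I₄)
    (hI₅ : Ex D.law (fun ω => Real.logb 2 (rvDist D.law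
          (fun ω => ((vY3 ω, vX2 ω), (vYH ω, vT1 ω))) ((vY3 ω, vX2 ω), (vYH ω, vT1 ω))))
      - Ex D.law (fun ω => Real.logb 2 (rvDist D.law (fun ω => (vY3 ω, vX2 ω)) (vY3 ω, vX2 ω)
        * (D.qH (vX2 ω) (vYH ω) * D.qT (vT1 ω)))) = I₅) :
    ∃ c : ℝ, ∀ n : ℕ, 0 < n → ∀ (Ms Mo Ix Jx : Type) [Fintype Ms] [Fintype Mo] [Fintype Ix]
      [Fintype Jx] [DecidableEq Ms] [DecidableEq Mo] [DecidableEq Ix] [DecidableEq Jx]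
      [Nonempty Ms] [Nonempty Mo] [Nonempty Ix] [Nonempty Jx]
      (Q : Mo × Ms → ℝ), IsPmf Q →
      ∃ C : BlockCode (Fin n → S) (Fin n → X₁) (Fin n → X₂) (Fin n → Y₂) (Fin n → Y₃) Mo Ms,
        Ex Q (fun x => (D.pow n).blockErr C x.1 x.2) ≤
          4 * (c / n + ((Fintype.card Mo : ℝ) - 1) * (1 / (2 : ℝ) ^ ((n : ℝ) * (I₃ - δ))) + c / n
            + ((Fintype.card Ms : ℝ) - 1) * Fintype.card Ix * (1 / (2 : ℝ) ^ ((n : ℝ) * (I₄ - δ)))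
            + ((Fintype.card Ms : ℝ) - 1) * Fintype.card Ix * ((Fintype.card Jx : ℝ) - 1)
              * (1 / (2 : ℝ) ^ ((n : ℝ) * (I₅ - δ))))
          + 2 * (16 * (2 : ℝ) ^ ((n : ℝ) * (I₂ + δ)) / (Fintype.card Mo * Fintype.card Jx)
            + 4 * (c / n))
          + 16 * (2 : ℝ) ^ ((n : ℝ) * (I₁ + δ)) / Fintype.card Ix + 4 * (c / n) := by
  obtain ⟨c₁, hc₁⟩ := exists_lln_upper isPmf_law
    (fun ω hω => ⟨(pos_of_law_pos hω).2.2.1, hD.qT_pos hω⟩) hδ hI₁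
  obtain ⟨c₂, hc₂⟩ := exists_lln_upper isPmf_law
    (fun ω hω => ⟨(pos_of_law_pos hω).2.2.2, hD.qH_pos hω⟩) hδ hI₂
  obtain ⟨c₃, hc₃⟩ := exists_lln_lower isPmf_law
    (fun ω hω => ⟨rvDist_pos isPmf_law.1 (fun ω => (vY3 ω, vX2 ω)) hω,
      mul_pos (rvDist_pos isPmf_law.1 vY3 hω) (pos_of_law_pos hω).2.1⟩) hδ hI₃
  obtain ⟨c₄, hc₄⟩ := exists_lln_lower isPmf_law
    (fun ω hω => ⟨rvDist_pos isPmf_law.1 (fun ω => (((vY3 ω, vX2 ω), vYH ω), vT1 ω)) hω,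
      mul_pos (rvDist_pos isPmf_law.1 (fun ω => ((vY3 ω, vX2 ω), vYH ω)) hω)
        (hD.qT_pos hω)⟩) hδ hI₄
  obtain ⟨c₅, hc₅⟩ := exists_lln_lower isPmf_law
    (fun ω hω => ⟨rvDist_pos isPmf_law.1 (fun ω => ((vY3 ω, vX2 ω), (vYH ω, vT1 ω))) hω,
      mul_pos (rvDist_pos isPmf_law.1 (fun ω => (vY3 ω, vX2 ω)) hω)
        (mul_pos (hD.qH_pos hω) (hD.qT_pos hω))⟩) hδ hI₅
  refine ⟨|c₁| + |c₂| + |c₃| + |c₄| + |c₅|, fun n hn Ms Mo Ix Jx => ?_⟩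
  intro _ _ _ _ _ _ _ _ _ _ _ _ Q hQ
  set c := |c₁| + |c₂| + |c₃| + |c₄| + |c₅| with hc
  have hle : ∀ c', c' ≤ c → c' / n ≤ c / n := fun c' h => by gcongr
  have hpow : ∀ x : ℝ, 0 < (2 : ℝ) ^ x := fun x => by positivity
  have hη₁ : (D.pow n).ideal (fun s t _ _ _ _ => ind ((2 : ℝ) ^ ((n : ℝ) * (I₁ + δ))
      * (D.pow n).qT t < (D.pow n).pT s t)) ≤ c / n := by
    rw [pow_ideal h₂]
    refine (hc₁ n hn).trans (hle _ ?_)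
    linarith [le_abs_self c₁, abs_nonneg c₂, abs_nonneg c₃, abs_nonneg c₄, abs_nonneg c₅]
  have hη₂ : (D.pow n).ideal (fun _ _ _ x y a => ind ((2 : ℝ) ^ ((n : ℝ) * (I₂ + δ))
      * (D.pow n).qH x a < (D.pow n).pH ((D.pow n).π₂ y) x a)) ≤ c / n := by
    rw [pow_ideal h₂]
    simp only [pow, h₂]
    refine (hc₂ n hn).trans (hle _ ?_)
    linarith [le_abs_self c₂, abs_nonneg c₁, abs_nonneg c₃, abs_nonneg c₄, abs_nonneg c₅]
  have hα₀ : (D.pow n).ideal (fun _ _ _ x y _ =>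
      ind (¬D.binTest (2 ^ ((n : ℝ) * (I₃ - δ))) x ((D.pow n).π₃ y))) ≤ c / n := by
    rw [pow_ideal h₂]
    simp only [pow, h₃]
    refine (hc₃ n hn).trans (hle _ ?_)
    linarith [le_abs_self c₃, abs_nonneg c₁, abs_nonneg c₂, abs_nonneg c₄, abs_nonneg c₅]
  have hα₁ : (D.pow n).ideal (fun _ _ _ _ y _ => Ex (D.pow n).pX2 fun x' =>
      ind (D.binTest (2 ^ ((n : ℝ) * (I₃ - δ))) x' ((D.pow n).π₃ y)))
      ≤ 1 / (2 : ℝ) ^ ((n : ℝ) * (I₃ - δ)) := by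
    rw [pow_ideal h₂]
    simp only [pow, h₃]
    exact packing_kernel isPmf_law vY3 (κ := fun _ => D.pX2) (fun _ => D.hpX2)
      (isPmf_rvDist isPmf_law fun ω => (vY3 ω, vX2 ω)) (hpow _)
      (P := fun y x => D.binTest (2 ^ ((n : ℝ) * (I₃ - δ))) x y) fun _ _ h => h
  have hβ₀ : (D.pow n).ideal (fun _ t _ x y a =>
      ind (¬D.msgTest (2 ^ ((n : ℝ) * (I₄ - δ))) (2 ^ ((n : ℝ) * (I₅ - δ))) x t a
        ((D.pow n).π₃ y))) ≤ c / n := by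
    rw [pow_ideal h₂]
    simp only [pow, h₃]
    refine le_trans ((Ex_mono (isPmf_piPmf fun _ => isPmf_law).1 fun ω => ?_).trans
      ((Ex_add _ _ _).trans_le (add_le_add (hc₄ n hn) (hc₅ n hn)))) ?_
    · refine ind_le_of_imp (add_nonneg (ind_nonneg _) (ind_nonneg _)) fun h => ?_
      rcases not_and_or.1 h with h | h
      · rw [ind_true h]
        exact le_add_of_nonneg_right (ind_nonneg _)
      · rw [ind_true h]
        exact le_add_of_nonneg_left (ind_nonneg _)
    · rw [← add_div]
      refine hle _ ?_
      linarith [le_abs_self c₄, le_abs_self c₅, abs_nonneg c₁, abs_nonneg c₂, abs_nonneg c₃]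
  have hβ₁ : (D.pow n).ideal (fun _ _ _ x y a => Ex (D.pow n).qT fun t' =>
      ind (D.msgTest (2 ^ ((n : ℝ) * (I₄ - δ))) (2 ^ ((n : ℝ) * (I₅ - δ))) x t' a
        ((D.pow n).π₃ y))) ≤ 1 / (2 : ℝ) ^ ((n : ℝ) * (I₄ - δ)) := by
    rw [pow_ideal h₂]
    simp only [pow, h₃]
    exact packing_kernel isPmf_law (fun ω => ((vY3 ω, vX2 ω), vYH ω)) (κ := fun _ => D.qT)
      (fun _ => D.hqT)
      (isPmf_rvDist isPmf_law fun ω => (((vY3 ω, vX2 ω), vYH ω), vT1 ω)) (hpow _)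
      (P := fun v t => D.msgTest (2 ^ ((n : ℝ) * (I₄ - δ))) (2 ^ ((n : ℝ) * (I₅ - δ)))
        (fun i => (v i).1.2) t (fun i => (v i).2) fun i => (v i).1.1) fun _ _ h => h.1
  have hβ₂ : (D.pow n).ideal (fun _ _ _ x y _ => Ex ((D.pow n).qH x) fun a' =>
      Ex (D.pow n).qT fun t' => ind (D.msgTest (2 ^ ((n : ℝ) * (I₄ - δ)))
        (2 ^ ((n : ℝ) * (I₅ - δ))) x t' a' ((D.pow n).π₃ y)))
      ≤ 1 / (2 : ℝ) ^ ((n : ℝ) * (I₅ - δ)) := by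
    rw [pow_ideal h₂]
    simp only [pow, h₃]
    have h := packing_kernel isPmf_law (fun ω => (vY3 ω, vX2 ω))
      (κ := fun v => compPmf (D.qH v.2) fun _ => D.qT)
      (fun _ => isPmf_compPmf (D.hqH _) fun _ => D.hqT)
      (isPmf_rvDist isPmf_law fun ω => ((vY3 ω, vX2 ω), (vYH ω, vT1 ω))) (hpow _)
      (P := fun v (z : Fin n → H × T) => D.msgTest (2 ^ ((n : ℝ) * (I₄ - δ)))
        (2 ^ ((n : ℝ) * (I₅ - δ))) (fun i => (v i).2) (fun i => (z i).2) (fun i => (z i).1)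
        fun i => (v i).1) fun _ _ h => h.2
    simp only [Ex_piPmf_compPmf] at h
    exact h
  exact (D.pow n).exists_blockCode Ix Jx (hpow _) (hpow _) hη₁ hη₂ hα₀ hα₁ hβ₀ hβ₁ hβ₂ le_rfl hQ

end RelayModel

/-! ### Choice of rates -/

lemma isPmf_Ex {A B : Type} [Fintype A] [Fintype B] {p : B → ℝ} {κ : B → A → ℝ} (hp : IsPmf p)
    (hκ : ∀ b, IsPmf (κ b)) : IsPmf fun a => Ex p fun b => κ b a := by
  refine ⟨fun a => Ex_nonneg hp.1 fun b => (hκ b).1 a, ?_⟩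
  rw [← Ex_sum p (fun a b => κ b a) univ]
  simp only [(hκ _).2, Ex_const hp]

lemma Ex_Ex {A B : Type} [Fintype A] [Fintype B] (p : B → ℝ) (κ : B → A → ℝ) (F : A → ℝ) :
    Ex (fun a => Ex p fun b => κ b a) F = Ex p fun b => Ex (κ b) F := by
  simp only [Ex, Finset.sum_mul, Finset.mul_sum, mul_assoc]
  exact sum_comm

lemma two_rpow_mul_le {n : ℕ} {a b δ : ℝ} (h : a + δ ≤ b) :
    (2 : ℝ) ^ ((n : ℝ) * a) / (2 : ℝ) ^ ((n : ℝ) * b) ≤ (2 : ℝ) ^ (-((n : ℝ) * δ)) := by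
  rw [← Real.rpow_sub (by norm_num)]
  refine Real.rpow_le_rpow_of_exponent_le (by norm_num) ?_
  have := mul_le_mul_of_nonneg_left h n.cast_nonneg (α := ℝ)
  linarith

lemma error_bound_le {n : ℕ} {I₁ I₂ I₃ I₄ I₅ R δ c kI kJ kM kW : ℝ} (hδ : 0 < δ)
    (hR : R + I₁ + 10 * δ ≤ I₄) (hI : I₂ + I₄ - I₅ ≤ I₃)
    (hM : (2 : ℝ) ^ ((n : ℝ) * (I₃ - 2 * δ)) ≤ kM)
    (hM' : kM - 1 ≤ (2 : ℝ) ^ ((n : ℝ) * (I₃ - 2 * δ)))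
    (hJ : (2 : ℝ) ^ ((n : ℝ) * (I₂ - I₃ + 4 * δ)) ≤ kJ) (hJ1 : 1 ≤ kJ)
    (hJ' : kJ - 1 ≤ (2 : ℝ) ^ ((n : ℝ) * (I₂ - I₃ + 4 * δ)))
    (hK : (2 : ℝ) ^ ((n : ℝ) * (I₁ + 2 * δ)) ≤ kI)
    (hK' : kI ≤ 2 * (2 : ℝ) ^ ((n : ℝ) * (I₁ + 2 * δ)))
    (hW' : kW - 1 ≤ (2 : ℝ) ^ ((n : ℝ) * R)) :
    4 * (c / n + (kM - 1) * (1 / (2 : ℝ) ^ ((n : ℝ) * (I₃ - δ))) + c / n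
        + (kW - 1) * kI * (1 / (2 : ℝ) ^ ((n : ℝ) * (I₄ - δ)))
        + (kW - 1) * kI * (kJ - 1) * (1 / (2 : ℝ) ^ ((n : ℝ) * (I₅ - δ))))
      + 2 * (16 * (2 : ℝ) ^ ((n : ℝ) * (I₂ + δ)) / (kM * kJ) + 4 * (c / n))
      + 16 * (2 : ℝ) ^ ((n : ℝ) * (I₁ + δ)) / kI + 4 * (c / n)
    ≤ 20 * (c / n) + 68 * (2 : ℝ) ^ (-((n : ℝ) * δ)) := by
  have hpow : ∀ x : ℝ, 0 < (2 : ℝ) ^ x := fun x => by positivity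
  have hI0 : 0 < kI := (hpow _).trans_le hK
  have hWI : (kW - 1) * kI ≤ 2 * (2 : ℝ) ^ ((n : ℝ) * (R + I₁ + 2 * δ)) := by
    calc (kW - 1) * kI ≤ (2 : ℝ) ^ ((n : ℝ) * R) * (2 * (2 : ℝ) ^ ((n : ℝ) * (I₁ + 2 * δ))) := by
          gcongr
      _ = 2 * ((2 : ℝ) ^ ((n : ℝ) * R) * (2 : ℝ) ^ ((n : ℝ) * (I₁ + 2 * δ))) := by ring
      _ = _ := by
          rw [← Real.rpow_add (by norm_num)]
          ring_nf
  have hWIJ : (kW - 1) * kI * (kJ - 1)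
      ≤ 2 * (2 : ℝ) ^ ((n : ℝ) * (R + I₁ + 2 * δ + (I₂ - I₃ + 4 * δ))) := by
    rw [mul_add _ (R + I₁ + 2 * δ), Real.rpow_add (by norm_num), ← mul_assoc]
    have : 0 ≤ kJ - 1 := by linarith
    gcongr
  have h1 : (kM - 1) * (1 / (2 : ℝ) ^ ((n : ℝ) * (I₃ - δ))) ≤ (2 : ℝ) ^ (-((n : ℝ) * δ)) := by
    rw [mul_one_div]
    refine le_trans ?_ (two_rpow_mul_le (a := I₃ - 2 * δ) (by linarith : _ ≤ I₃ - δ))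
    gcongr
  have h2 : (kW - 1) * kI * (1 / (2 : ℝ) ^ ((n : ℝ) * (I₄ - δ)))
      ≤ 2 * (2 : ℝ) ^ (-((n : ℝ) * δ)) := by
    rw [mul_one_div]
    refine le_trans ?_ (mul_le_mul_of_nonneg_left
      (two_rpow_mul_le (a := R + I₁ + 2 * δ) (by linarith : _ ≤ I₄ - δ)) zero_le_two)
    rw [← mul_div_assoc]
    gcongr
  have h3 : (kW - 1) * kI * (kJ - 1) * (1 / (2 : ℝ) ^ ((n : ℝ) * (I₅ - δ)))
      ≤ 2 * (2 : ℝ) ^ (-((n : ℝ) * δ)) := by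
    rw [mul_one_div]
    refine le_trans ?_ (mul_le_mul_of_nonneg_left (two_rpow_mul_le
      (a := R + I₁ + 2 * δ + (I₂ - I₃ + 4 * δ)) (by linarith : _ ≤ I₅ - δ)) zero_le_two)
    rw [← mul_div_assoc]
    gcongr
  have h4 : 16 * (2 : ℝ) ^ ((n : ℝ) * (I₂ + δ)) / (kM * kJ)
      ≤ 16 * (2 : ℝ) ^ (-((n : ℝ) * δ)) := by
    rw [mul_div_assoc]
    refine mul_le_mul_of_nonneg_left (le_trans ?_ (two_rpow_mul_le (a := I₂ + δ)
      (by linarith : _ ≤ I₃ - 2 * δ + (I₂ - I₃ + 4 * δ)))) (by norm_num)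
    rw [mul_add _ (I₃ - 2 * δ), Real.rpow_add (by norm_num)]
    have := (hpow _).trans_le hM
    gcongr
  have h5 : 16 * (2 : ℝ) ^ ((n : ℝ) * (I₁ + δ)) / kI ≤ 16 * (2 : ℝ) ^ (-((n : ℝ) * δ)) := by
    rw [mul_div_assoc]
    refine mul_le_mul_of_nonneg_left (le_trans ?_ (two_rpow_mul_le (a := I₁ + δ)
      (by linarith : _ ≤ I₁ + 2 * δ))) (by norm_num)
    gcongr
  linarith

lemma exists_error_lt (c : ℝ) {δ ε : ℝ} (hδ : 0 < δ) (hε : 0 < ε) :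
    ∃ n : ℕ, 0 < n ∧ 20 * (c / n) + 68 * (2 : ℝ) ^ (-((n : ℝ) * δ)) < ε := by
  have h1 : Filter.Tendsto (fun n : ℕ => c / (n : ℝ)) Filter.atTop (nhds 0) :=
    tendsto_const_div_atTop_nhds_zero_nat c
  have h2 : Filter.Tendsto (fun n : ℕ => (2 : ℝ) ^ (-((n : ℝ) * δ))) Filter.atTop (nhds 0) := by
    have h := tendsto_pow_atTop_nhds_zero_of_lt_one (r := (2 : ℝ) ^ (-δ)) (by positivity)
      (Real.rpow_lt_one_of_one_lt_of_neg (by norm_num) (by linarith))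
    refine h.congr fun n => ?_
    rw [← Real.rpow_natCast, ← Real.rpow_mul (by norm_num)]
    ring_nf
  have h3 := (h1.const_mul 20).add (h2.const_mul 68)
  rw [mul_zero, mul_zero, add_zero] at h3
  obtain ⟨n, hn, hn'⟩ := ((h3.eventually_lt_const hε).and (Filter.eventually_gt_atTop 0)).exists
  exact ⟨n, hn', hn⟩

lemma natCeil_sub_one_le {x : ℝ} (hx : 0 < x) : (⌈x⌉₊ : ℝ) - 1 ≤ x := by
  linarith [Nat.ceil_lt_add_one hx.le]

/-- **SD-RC with non-causal perfect CSI only at the source.**  If random variables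
`T₁, X₂, Ŷ₂` together with `(S, X₁, Y₂, Y₃)` have a joint pmf factoring as
`p(s) p(x₂) p(t₁|s) p(x₁|t₁,s) p(y₂,y₃|x₁,x₂,s) p(ŷ₂|y₂,x₂)`, and
`R13 < I(T₁;Ŷ₂,Y₃|X₂) − I(T₁;S)` subject to
`I(Ŷ₂;Y₂|X₂,Y₃) ≤ I(X₂;Y₃)`, then the rate `R13` is achievable. -/
theorem sdrc_noncausal_source_achievable
    {𝒳₁ 𝒳₂ 𝒴₂ 𝒴₃ 𝒮 T₁ YH : Type}
    [Fintype 𝒳₁] [Fintype 𝒳₂] [Fintype 𝒴₂] [Fintype 𝒴₃] [Fintype 𝒮]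
    [Fintype T₁] [Fintype YH]
    (pS : 𝒮 → ℝ) (hpS : IsPmf pS)
    (W : 𝒳₁ → 𝒳₂ → 𝒮 → 𝒴₂ × 𝒴₃ → ℝ) (hW : ∀ x1 x2 s, IsPmf (W x1 x2 s))
    (pX2 : 𝒳₂ → ℝ) (hpX2 : IsPmf pX2)
    (pT : 𝒮 → T₁ → ℝ) (hpT : IsKernel pT)
    (pX1 : T₁ × 𝒮 → 𝒳₁ → ℝ) (hpX1 : IsKernel pX1)
    (pYH : 𝒴₂ × 𝒳₂ → YH → ℝ) (hpYH : IsKernel pYH)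
    (μ : ΩRCsrc 𝒮 T₁ 𝒳₁ 𝒳₂ 𝒴₂ 𝒴₃ YH → ℝ)
    (hμ : ∀ s t1 x1 x2 y2 y3 yh,
      μ (s, t1, x1, x2, y2, y3, yh) =
        pS s * pX2 x2 * pT s t1 * pX1 (t1, s) x1 * W x1 x2 s (y2, y3) *
          pYH (y2, x2) yh)
    (R13 : ℝ) (hR13 : 0 ≤ R13)
    (h1 : R13 < rvCMI μ vT1 (fun ω => (vYH ω, vY3 ω)) vX2 - rvMI μ vT1 vS)
    (h2 : rvCMI μ vYH vY2 (fun ω => (vX2 ω, vY3 ω)) ≤ rvMI μ vX2 vY3) :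
    AchievableRCsrc pS W R13 := by
  intro ε hε
  let D : RelayModel 𝒮 T₁ 𝒳₁ 𝒳₂ (𝒴₂ × 𝒴₃) 𝒴₂ 𝒴₃ YH :=
    { pS := pS
      pT := pT
      pX1 := fun t s => pX1 (t, s)
      pX2 := pX2
      W := W
      pH := fun y x => pYH (y, x)
      qT := fun t => Ex pS fun s => pT s t
      qH := fun x a => Ex pS fun s => Ex (pT s) fun t => Ex (pX1 (t, s)) fun x₁ =>
        Ex (W x₁ x s) fun y => pYH (y.1, x) a
      π₂ := Prod.fst
      π₃ := Prod.snd
      hpS := hpS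
      hpT := hpT
      hpX1 := fun _ _ => hpX1 _
      hpX2 := hpX2
      hW := hW
      hpH := fun _ _ => hpYH _
      hqT := isPmf_Ex hpS hpT
      hqH := fun _ => isPmf_Ex hpS fun _ => isPmf_Ex (hpT _) fun _ => isPmf_Ex (hpX1 _) fun _ =>
        isPmf_Ex (hW _ _ _) fun _ => hpYH _ }
  have hμD : μ = D.law := funext fun ⟨s, t1, x1, x2, y2, y3, yh⟩ => hμ s t1 x1 x2 y2 y3 yh
  have hD : D.IsMarginal := by
    refine ⟨(rvDist_eq_of_Ex fun F => ?_).symm, fun x a => ?_⟩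
    · rw [RelayModel.Ex_law fun _ t _ _ _ _ _ => F t]
      simp only [Ex_const D.hpX2, Ex_const (D.hpX1 _ _), Ex_const (D.hW _ _ _),
        Ex_const (D.hpH _ _)]
      simp only [D, Ex_Ex]
    · have h : rvDist D.law (fun ω => (vX2 ω, vYH ω)) = compPmf D.pX2 D.qH := by
        refine rvDist_eq_of_Ex fun F => ?_
        rw [RelayModel.Ex_law fun _ _ _ x _ _ a => F (x, a), Ex_compPmf]
        simp only [D, Ex_Ex]
      rw [h, compPmf]
  rw [hμD] at h1 h2
  set I₁ := rvMI D.law vT1 vS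
  set I₃ := rvMI D.law vX2 vY3
  set I₄ := rvCMI D.law vT1 (fun ω => (vYH ω, vY3 ω)) vX2
  have hI₁ : 0 ≤ I₁ := hD.rvMI_T_S_nonneg
  have hrate := hD.quantization_rate_le
  set R := (R13 + I₄ - I₁) / 2 with hR
  set δ := (I₄ - I₁ - R) / 10 with hδdef
  have hRR : R13 < R := by linarith
  have hδ : 0 < δ := by linarith
  obtain ⟨c, hc⟩ := RelayModel.exists_blockCode_pow hD rfl rfl hδ hD.rvMI_T_S rfl
    RelayModel.IsMarginal.rvMI_X2_Y3 hD.rvCMI_T_H_Y3 rfl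
  set I₂ := Ex D.law (fun ω => Real.logb 2 (D.pH (vY2 ω) (vX2 ω) (vYH ω)))
      - Ex D.law (fun ω => Real.logb 2 (D.qH (vX2 ω) (vYH ω)))
  set I₅ := Ex D.law (fun ω => Real.logb 2 (rvDist D.law
          (fun ω => ((vY3 ω, vX2 ω), (vYH ω, vT1 ω))) ((vY3 ω, vX2 ω), (vYH ω, vT1 ω))))
      - Ex D.law (fun ω => Real.logb 2 (rvDist D.law (fun ω => (vY3 ω, vX2 ω)) (vY3 ω, vX2 ω)
        * (D.qH (vX2 ω) (vYH ω) * D.qT (vT1 ω))))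
  obtain ⟨B, hB⟩ := exists_nat_ge (R13 / (R - R13))
  rw [div_le_iff₀ (by linarith)] at hB
  obtain ⟨n, hn, hnε⟩ := exists_error_lt c hδ (ε := ε / (B + 1 : ℕ)) (by positivity)
  have hpow : ∀ x : ℝ, 0 < (2 : ℝ) ^ x := fun x => by positivity
  let k : ℝ → ℕ := fun r => ⌈(2 : ℝ) ^ ((n : ℝ) * r)⌉₊
  have hk0 : ∀ r, NeZero (k r) := fun r => ⟨(Nat.ceil_pos.2 (hpow _)).ne'⟩
  have hk1 : ∀ r, (2 : ℝ) ^ ((n : ℝ) * r) ≤ k r := fun r => Nat.le_ceil _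
  have hk2 : ∀ r, (k r : ℝ) - 1 ≤ (2 : ℝ) ^ ((n : ℝ) * r) := fun r => natCeil_sub_one_le (hpow _)
  have hbound := fun Q hQ => (hc n hn (Fin (k R)) (Fin (k (I₃ - 2 * δ))) (Fin (k (I₁ + 2 * δ)))
    (Fin (k (I₂ - I₃ + 4 * δ))) Q hQ)
  simp only [Fintype.card_fin] at hbound
  have herr := error_bound_le (n := n) (c := c) hδ (by linarith : R + I₁ + 10 * δ ≤ I₄)
    (by linarith : I₂ + I₄ - I₅ ≤ I₃) (hk1 _) (hk2 _) (hk1 _)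
    (by exact_mod_cast Nat.ceil_pos.2 (hpow _)) (hk2 _) (hk1 (I₁ + 2 * δ)) (by
      have : (1 : ℝ) ≤ (2 : ℝ) ^ ((n : ℝ) * (I₁ + 2 * δ)) :=
        Real.one_le_rpow (by norm_num) (by positivity)
      linarith [hk2 (I₁ + 2 * δ)]) (hk2 R)
  obtain ⟨enc1, enc2, dec2, hcausal, he⟩ := (D.pow n).exists_code_of_blockCodes (pS := pS)
    (W := W) (fun _ => rfl) (fun _ _ _ _ => rfl) (fun _ => rfl) (fun _ => rfl)
    (fun Q hQ => (hbound Q hQ).imp fun C hC => hC.trans (herr.trans hnε.le)) 0 B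
  refine ⟨(B + 1) * n, _, enc1, enc2, dec2, by positivity, ?_, hcausal, he.trans_eq ?_⟩
  · rw [Fintype.card_fin]
    push_cast
    refine le_trans ?_ (pow_le_pow_left₀ (hpow _).le (hk1 R) B)
    rw [← Real.rpow_natCast, ← Real.rpow_mul (by norm_num)]
    refine Real.rpow_le_rpow_of_exponent_le (by norm_num) ?_
    have : (B + 1) * R13 ≤ B * R := by linarith
    have := mul_le_mul_of_nonneg_left this n.cast_nonneg (α := ℝ)
    linarith
  · field_simp

end
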